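/- arXiv:1501.06603 — 18 statements merged into one kernel-verified Lean document; each statement's English description precedes it below -/
import Mathlib

section
/- Let (a_n) and (b_n) be sequences of real numbers such that (b_n) is unbounded and either strictly monotone increasing or strictly monotone decreasing. Then, with all limits taken in the extended real numbers as n → ∞: liminf (a_{n+1} − a_n)/(b_{n+1} − b_n) ≤ liminf a_n/b_n ≤ limsup a_n/b_n ≤ limsup (a_{n+1} − a_n)/(b_{n+1} − b_n). -/
open Filter

/-- The lower half of the Stolz–Cesàro theorem, for an increasing denominator. -/
theorem liminf_div_sub_le_liminf_div_of_strictMono {a b : ℕ → ℝ}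
    (hb : StrictMono b) (hb_top : Tendsto b atTop atTop) :
    liminf (fun n => (((a (n + 1) - a n) / (b (n + 1) - b n) : ℝ) : EReal)) atTop
      ≤ liminf (fun n => ((a n / b n : ℝ) : EReal)) atTop := by
  refine le_of_forall_lt fun x hx => ?_
  obtain ⟨c, hxc, hc⟩ := EReal.lt_iff_exists_real_btwn.1 hx
  obtain ⟨d, hcd, hd⟩ := EReal.lt_iff_exists_real_btwn.1 hc
  refine hxc.trans_le (le_liminf_of_le (by isBoundedDefault) ?_)
  obtain ⟨N, hN⟩ := eventually_atTop.1 (eventually_lt_of_lt_liminf hd)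
  have hmono : ∀ n ≥ N, a N - d * b N ≤ a n - d * b n := by
    intro n hn
    induction n, hn using Nat.le_induction with
    | base => exact le_rfl
    | succ n hn ih =>
      have h := (lt_div_iff₀ (sub_pos.2 (hb n.lt_succ_self))).1 (EReal.coe_lt_coe_iff.1 (hN n hn))
      simp only [Nat.succ_eq_add_one] at h
      linarith
  have hpos : 0 < d - c := sub_pos.2 (EReal.coe_lt_coe_iff.1 hcd)
  filter_upwards [eventually_ge_atTop N, hb_top.eventually_gt_atTop 0,
    (hb_top.const_mul_atTop hpos).eventually_ge_atTop (-(a N - d * b N))] with n hn hbn hK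
  rw [EReal.coe_le_coe_iff, le_div_iff₀ hbn]
  linarith [hmono n hn]

/-- The upper half of the Stolz–Cesàro theorem, for an increasing denominator. -/
theorem limsup_div_le_limsup_div_sub_of_strictMono {a b : ℕ → ℝ}
    (hb : StrictMono b) (hb_top : Tendsto b atTop atTop) :
    limsup (fun n => ((a n / b n : ℝ) : EReal)) atTop
      ≤ limsup (fun n => (((a (n + 1) - a n) / (b (n + 1) - b n) : ℝ) : EReal)) atTop := by
  have h := liminf_div_sub_le_liminf_div_of_strictMono (a := fun n => -a n) hb hb_top
  have neg_liminf (u : ℕ → ℝ) :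
      liminf (fun n => ((-u n : ℝ) : EReal)) atTop = -limsup (fun n => (u n : EReal)) atTop := by
    rw [← EReal.liminf_neg]
    rfl
  simp only [← neg_sub', neg_div, neg_liminf] at h
  exact EReal.neg_le_neg_iff.1 h

theorem StrictMono.tendsto_atTop_of_unbounded_abs {b : ℕ → ℝ} (hb : StrictMono b)
    (hb_unbounded : ¬ ∃ M : ℝ, ∀ n, |b n| ≤ M) : Tendsto b atTop atTop := by
  refine tendsto_atTop_atTop_of_monotone hb.monotone fun M => ?_
  by_contra! h
  refine hb_unbounded ⟨max M (-b 0), fun n => abs_le.2 ⟨?_, (h n).le.trans (le_max_left _ _)⟩⟩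
  linarith [hb.monotone n.zero_le, le_max_right M (-b 0)]

theorem stolz_cesaro_general (a b : ℕ → ℝ)
    (hb_unbounded : ¬ ∃ M : ℝ, ∀ n, |b n| ≤ M)
    (hb_mono : StrictMono b ∨ StrictAnti b) :
    liminf (fun n => (((a (n + 1) - a n) / (b (n + 1) - b n) : ℝ) : EReal)) atTop
      ≤ liminf (fun n => ((a n / b n : ℝ) : EReal)) atTop ∧
    liminf (fun n => ((a n / b n : ℝ) : EReal)) atTop
      ≤ limsup (fun n => ((a n / b n : ℝ) : EReal)) atTop ∧
    limsup (fun n => ((a n / b n : ℝ) : EReal)) atTop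
      ≤ limsup (fun n => (((a (n + 1) - a n) / (b (n + 1) - b n) : ℝ) : EReal)) atTop := by
  wlog hb : StrictMono b generalizing a b
  · have hb' : StrictMono fun n => -b n := (hb_mono.resolve_left hb).neg
    have h := this (fun n => -a n) (fun n => -b n) (by simpa only [abs_neg] using hb_unbounded)
      (Or.inl hb') hb'
    simpa only [← neg_sub', neg_div_neg_eq] using h
  have hb_top := hb.tendsto_atTop_of_unbounded_abs hb_unbounded
  exact ⟨liminf_div_sub_le_liminf_div_of_strictMono hb hb_top, liminf_le_limsup,
    limsup_div_le_limsup_div_sub_of_strictMono hb hb_top⟩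
end

section
/- For every sequence (x_n) of real numbers, with all limits taken in the extended real numbers as n → ∞: liminf (x_{n+1} − x_n) ≤ liminf x_n/n ≤ limsup x_n/n ≤ limsup (x_{n+1} − x_n). -/
open Filter

theorem limsup_div_le_limsup_sub (x : ℕ → ℝ) :
    limsup (fun n => ((x n / n : ℝ) : EReal)) atTop
      ≤ limsup (fun n => ((x (n + 1) - x n : ℝ) : EReal)) atTop := by
  refine EReal.le_of_forall_lt_iff_le.1 fun z hz => ?_
  obtain ⟨N, hN⟩ := eventually_atTop.1 (eventually_lt_of_limsup_lt hz)
  have hbound : ∀ n ≥ N, x n ≤ (x N - N * z) + n * z := by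
    intro n hn
    induction n, hn using Nat.le_induction with
    | base => linarith
    | succ n hn ih =>
      have hstep := EReal.coe_lt_coe_iff.1 (hN n hn)
      push_cast
      linarith
  have hlim : Tendsto (fun n : ℕ => (((x N - N * z) / n + z : ℝ) : EReal)) atTop
      (nhds (z : EReal)) := by
    refine (continuous_coe_real_ereal.tendsto z).comp ?_
    simpa using (tendsto_const_div_atTop_nhds_zero_nat (x N - N * z)).add_const z
  rw [← hlim.limsup_eq]
  refine limsup_le_limsup ?_
  filter_upwards [eventually_ge_atTop N, eventually_gt_atTop 0] with n hn hpos
  have hn0 : (0 : ℝ) < n := Nat.cast_pos.2 hpos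
  rw [EReal.coe_le_coe_iff, div_le_iff₀ hn0, add_mul, div_mul_cancel₀ _ hn0.ne']
  linarith [hbound n hn]

theorem liminf_sub_le_liminf_div (x : ℕ → ℝ) :
    liminf (fun n => ((x (n + 1) - x n : ℝ) : EReal)) atTop
      ≤ liminf (fun n => ((x n / n : ℝ) : EReal)) atTop := by
  rw [← EReal.neg_le_neg_iff, ← EReal.limsup_neg, ← EReal.limsup_neg]
  convert limsup_div_le_limsup_sub (fun n => -x n) using 3 with n n
  · rw [Pi.neg_apply, ← EReal.coe_neg, neg_div]
  · rw [Pi.neg_apply, ← EReal.coe_neg]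
    congr 1
    ring

theorem cesaro_corollary (x : ℕ → ℝ) :
    liminf (fun n => ((x (n + 1) - x n : ℝ) : EReal)) atTop
      ≤ liminf (fun n => ((x n / n : ℝ) : EReal)) atTop ∧
    liminf (fun n => ((x n / n : ℝ) : EReal)) atTop
      ≤ limsup (fun n => ((x n / n : ℝ) : EReal)) atTop ∧
    limsup (fun n => ((x n / n : ℝ) : EReal)) atTop
      ≤ limsup (fun n => ((x (n + 1) - x n : ℝ) : EReal)) atTop :=
  ⟨liminf_sub_le_liminf_div x, liminf_le_limsup, limsup_div_le_limsup_sub x⟩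
end

section
/- Let g : (0,∞) → (0,∞) be increasing and let H be an antiderivative of −1/g. Let (β_n) and (δ_n) be sequences of strictly positive real numbers with β_{n+1} = β_n − δ_n·g(β_n) for every n. Then: (i) for every n, δ_n ≤ H(β_{n+1}) − H(β_n) ≤ δ_n·g(β_n)/g(β_{n+1}); and (ii) liminf δ_n ≤ liminf H(β_n)/n ≤ limsup H(β_n)/n ≤ limsup (δ_n·g(β_n)/g(β_{n+1})), with the limits taken in the extended reals as n → ∞. -/
open Filter

/-- A Stolz–Cesàro inequality: if the increments of `u` dominate `a`, then
`liminf a ≤ liminf (u n / n)`. -/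
theorem liminf_le_liminf_div_of_le_sub {a u : ℕ → ℝ} (h : ∀ n, a n ≤ u (n + 1) - u n) :
    liminf (fun n => ((a n : ℝ) : EReal)) atTop
      ≤ liminf (fun n => ((u n / n : ℝ) : EReal)) atTop := by
  refine EReal.ge_of_forall_gt_iff_ge.1 fun c hc => ?_
  obtain ⟨N, hN⟩ := eventually_atTop.1 (eventually_lt_of_lt_liminf hc)
  have hlow : ∀ n, N ≤ n → u N + c * ((n : ℝ) - N) ≤ u n := by
    intro n hn
    induction n, hn using Nat.le_induction with
    | base => simp
    | succ n hn ih =>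
      have hcn : c < a n := EReal.coe_lt_coe_iff.1 (hN n hn)
      push_cast
      linarith [h n]
  have hlim : Tendsto (fun n : ℕ => c + (u N - c * N) / (n : ℝ)) atTop (nhds c) := by
    simpa using (tendsto_const_div_atTop_nhds_zero_nat (u N - c * N)).const_add c
  rw [← ((continuous_coe_real_ereal.tendsto c).comp hlim).liminf_eq]
  refine liminf_le_liminf ?_
  filter_upwards [eventually_ge_atTop N, eventually_gt_atTop 0] with n hn hn0
  have hn' : (0 : ℝ) < n := Nat.cast_pos.2 hn0
  refine EReal.coe_le_coe_iff.2 ?_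
  rw [le_div_iff₀ hn', add_mul, div_mul_cancel₀ _ hn'.ne']
  linarith [hlow n hn]

/-- A Stolz–Cesàro inequality: if the increments of `u` are dominated by `b`, then
`limsup (u n / n) ≤ limsup b`. -/
theorem limsup_div_le_limsup_of_sub_le {b u : ℕ → ℝ} (h : ∀ n, u (n + 1) - u n ≤ b n) :
    limsup (fun n => ((u n / n : ℝ) : EReal)) atTop
      ≤ limsup (fun n => ((b n : ℝ) : EReal)) atTop := by
  have key := liminf_le_liminf_div_of_le_sub (a := fun n => -b n) (u := fun n => -u n)
    fun n => by linarith [h n]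
  simp only [neg_div, EReal.coe_neg] at key
  have hneg : ∀ v : ℕ → EReal, liminf (fun n => -v n) atTop = -limsup v atTop :=
    fun v => EReal.liminf_neg
  rw [hneg, hneg] at key
  exact EReal.neg_le_neg_iff.1 key

/-- Mean value bounds for an antiderivative of `-1 / g` with `g` positive and increasing. -/
theorem div_le_sub_and_sub_le_div_of_hasDerivAt {g H : ℝ → ℝ}
    (hg_pos : ∀ x : ℝ, 0 < x → 0 < g x)
    (hg_mono : ∀ x y : ℝ, 0 < x → x ≤ y → g x ≤ g y)
    (hH : ∀ x : ℝ, 0 < x → HasDerivAt H (-1 / g x) x)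
    {x y : ℝ} (hx : 0 < x) (hxy : x < y) :
    (y - x) / g y ≤ H x - H y ∧ H x - H y ≤ (y - x) / g x := by
  obtain ⟨z, ⟨hxz, hzy⟩, hz⟩ := exists_hasDerivAt_eq_slope H (fun z => -1 / g z) hxy
    (fun z hz => (hH z (hx.trans_le hz.1)).continuousAt.continuousWithinAt)
    (fun z hz => hH z (hx.trans hz.1))
  have hyx : 0 < y - x := sub_pos.2 hxy
  have hz0 : 0 < z := hx.trans hxz
  have heq : H x - H y = (y - x) / g z := by
    rw [eq_div_iff hyx.ne'] at hz
    have : (y - x) / g z = -(-1 / g z * (y - x)) := by ring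
    rw [this, hz]
    ring
  rw [heq]
  exact ⟨div_le_div_of_nonneg_left hyx.le (hg_pos z hz0) (hg_mono z y hz0 hzy.le),
    div_le_div_of_nonneg_left hyx.le (hg_pos x hx) (hg_mono x z hx hxz.le)⟩

theorem prop_utility (g : ℝ → ℝ) (H : ℝ → ℝ)
    (hg_pos : ∀ x : ℝ, 0 < x → 0 < g x)
    (hg_mono : ∀ x y : ℝ, 0 < x → x ≤ y → g x ≤ g y)
    (hH : ∀ x : ℝ, 0 < x → HasDerivAt H (-1 / g x) x)
    (β δ : ℕ → ℝ)
    (hβ_pos : ∀ n, 0 < β n) (hδ_pos : ∀ n, 0 < δ n)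
    (hrec : ∀ n, β (n + 1) = β n - δ n * g (β n)) :
    (∀ n, δ n ≤ H (β (n + 1)) - H (β n) ∧
      H (β (n + 1)) - H (β n) ≤ δ n * g (β n) / g (β (n + 1))) ∧
    liminf (fun n => ((δ n : ℝ) : EReal)) atTop
      ≤ liminf (fun n => ((H (β n) / n : ℝ) : EReal)) atTop ∧
    liminf (fun n => ((H (β n) / n : ℝ) : EReal)) atTop
      ≤ limsup (fun n => ((H (β n) / n : ℝ) : EReal)) atTop ∧
    limsup (fun n => ((H (β n) / n : ℝ) : EReal)) atTop
      ≤ limsup (fun n => ((δ n * g (β n) / g (β (n + 1)) : ℝ) : EReal)) atTop := by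
  have hstep : ∀ n, δ n ≤ H (β (n + 1)) - H (β n) ∧
      H (β (n + 1)) - H (β n) ≤ δ n * g (β n) / g (β (n + 1)) := by
    intro n
    have hg := hg_pos _ (hβ_pos n)
    have hsub : β n - β (n + 1) = δ n * g (β n) := by rw [hrec n]; ring
    have hlt : β (n + 1) < β n := sub_pos.1 (hsub ▸ mul_pos (hδ_pos n) hg)
    have hmv := div_le_sub_and_sub_le_div_of_hasDerivAt hg_pos hg_mono hH (hβ_pos (n + 1)) hlt
    rwa [hsub, mul_div_cancel_right₀ _ hg.ne'] at hmv
  exact ⟨hstep, liminf_le_liminf_div_of_le_sub (u := fun n => H (β n)) fun n => (hstep n).1,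
    liminf_le_limsup, limsup_div_le_limsup_of_sub_le (u := fun n => H (β n)) fun n => (hstep n).2⟩
end

section
/- Let g : (0,∞) → (0,∞) be increasing and let H be an antiderivative of −1/g. Let (x_n) and (δ_n) be sequences of strictly positive real numbers with x_n = x_{n+1} + δ_n·g(x_{n+1}) for every n. Then: (i) for every n, δ_n·g(x_{n+1})/g(x_n) ≤ H(x_{n+1}) − H(x_n) ≤ δ_n; and (ii) liminf (δ_n·g(x_{n+1})/g(x_n)) ≤ liminf H(x_n)/n ≤ limsup H(x_n)/n ≤ limsup δ_n, with the limits taken in the extended reals as n → ∞. -/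
open Filter

/-- A sequence with increments bounded above by `u` has
`limsup (a n / n) ≤ limsup u`. -/
theorem limsup_div_natCast_le_limsup {a u : ℕ → ℝ} (h : ∀ n, a (n + 1) - a n ≤ u n) :
    limsup (fun n => ((a n / n : ℝ) : EReal)) atTop ≤ limsup (fun n => (u n : EReal)) atTop := by
  refine EReal.le_of_forall_lt_iff_le.mp fun c hc => ?_
  obtain ⟨N, hN⟩ := eventually_atTop.mp (eventually_lt_of_limsup_lt hc)
  have linear_bound : ∀ n ≥ N, a n ≤ (a N - c * N) + c * n := by
    intro n hn
    induction n, hn using Nat.le_induction with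
    | base => linarith
    | succ n hn ih =>
      have hu : u n < c := EReal.coe_lt_coe_iff.mp (hN n hn)
      push_cast
      linarith [h n]
  have hlim : Tendsto (fun n : ℕ => (((a N - c * N) / n + c : ℝ) : EReal)) atTop
      (nhds (c : EReal)) := by
    refine (continuous_coe_real_ereal.tendsto c).comp ?_
    simpa using (tendsto_const_div_atTop_nhds_zero_nat (a N - c * N)).add_const c
  rw [← hlim.limsup_eq]
  refine limsup_le_limsup ?_
  filter_upwards [eventually_ge_atTop N, eventually_gt_atTop 0] with n hn hn0
  have hn' : (0 : ℝ) < n := Nat.cast_pos.mpr hn0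
  refine EReal.coe_le_coe_iff.mpr ?_
  calc a n / n ≤ ((a N - c * N) + c * n) / n := by gcongr; exact linear_bound n hn
    _ = (a N - c * N) / n + c := by field_simp

/-- A sequence with increments bounded below by `u` has
`liminf u ≤ liminf (a n / n)`. -/
theorem liminf_le_liminf_div_natCast {a u : ℕ → ℝ} (h : ∀ n, u n ≤ a (n + 1) - a n) :
    liminf (fun n => (u n : EReal)) atTop ≤ liminf (fun n => ((a n / n : ℝ) : EReal)) atTop := by
  have key := limsup_div_natCast_le_limsup (a := fun n => -a n) (u := fun n => -u n)
    fun n => by linarith [h n]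
  have hneg (v : ℕ → ℝ) : limsup (fun n => ((-v n : ℝ) : EReal)) atTop
      = -liminf (fun n => (v n : EReal)) atTop := by
    rw [← EReal.limsup_neg]
    rfl
  simp only [neg_div] at key
  rwa [hneg u, hneg fun n => a n / n, EReal.neg_le_neg_iff] at key

/-- If `H` is an antiderivative of `-1 / g` on `(0, ∞)` with `g` positive and increasing, then the increment of `H` over
an interval is controlled by the values of `g` at its endpoints. -/
theorem antideriv_neg_inv_sub_bounds {g H : ℝ → ℝ}
    (hg_pos : ∀ x : ℝ, 0 < x → 0 < g x)
    (hg_mono : ∀ x y : ℝ, 0 < x → x ≤ y → g x ≤ g y)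
    (hH : ∀ x : ℝ, 0 < x → HasDerivAt H (-1 / g x) x) {y z : ℝ} (hy : 0 < y) (hyz : y < z) :
    (z - y) / g z ≤ H y - H z ∧ H y - H z ≤ (z - y) / g y := by
  obtain ⟨c, ⟨hyc, hcz⟩, hc⟩ := exists_hasDerivAt_eq_slope H (fun t => -1 / g t) hyz
    (fun t ht => (hH t (hy.trans_le ht.1)).continuousAt.continuousWithinAt)
    (fun t ht => hH t (hy.trans ht.1))
  have hzy : 0 < z - y := sub_pos.mpr hyz
  have hcpos : 0 < c := hy.trans hyc
  have hgc := hg_pos c hcpos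
  have increment : H y - H z = (z - y) / g c := by
    rw [eq_div_iff hzy.ne'] at hc
    linear_combination hc
  rw [increment]
  exact ⟨div_le_div_of_nonneg_left hzy.le hgc (hg_mono c z hcpos hcz.le),
    div_le_div_of_nonneg_left hzy.le (hg_pos y hy) (hg_mono y c hy hyc.le)⟩

theorem cor_utility (g : ℝ → ℝ) (H : ℝ → ℝ)
    (hg_pos : ∀ x : ℝ, 0 < x → 0 < g x)
    (hg_mono : ∀ x y : ℝ, 0 < x → x ≤ y → g x ≤ g y)
    (hH : ∀ x : ℝ, 0 < x → HasDerivAt H (-1 / g x) x)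
    (x δ : ℕ → ℝ)
    (hx_pos : ∀ n, 0 < x n) (hδ_pos : ∀ n, 0 < δ n)
    (hrec : ∀ n, x n = x (n + 1) + δ n * g (x (n + 1))) :
    (∀ n, δ n * g (x (n + 1)) / g (x n) ≤ H (x (n + 1)) - H (x n) ∧
      H (x (n + 1)) - H (x n) ≤ δ n) ∧
    liminf (fun n => ((δ n * g (x (n + 1)) / g (x n) : ℝ) : EReal)) atTop
      ≤ liminf (fun n => ((H (x n) / n : ℝ) : EReal)) atTop ∧
    liminf (fun n => ((H (x n) / n : ℝ) : EReal)) atTop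
      ≤ limsup (fun n => ((H (x n) / n : ℝ) : EReal)) atTop ∧
    limsup (fun n => ((H (x n) / n : ℝ) : EReal)) atTop
      ≤ limsup (fun n => ((δ n : ℝ) : EReal)) atTop := by
  have increments : ∀ n, δ n * g (x (n + 1)) / g (x n) ≤ H (x (n + 1)) - H (x n) ∧
      H (x (n + 1)) - H (x n) ≤ δ n := by
    intro n
    have hg := hg_pos _ (hx_pos (n + 1))
    have hdiff : x n - x (n + 1) = δ n * g (x (n + 1)) := by linarith [hrec n]
    have hlt : x (n + 1) < x n := by linarith [mul_pos (hδ_pos n) hg]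
    have bounds := antideriv_neg_inv_sub_bounds hg_pos hg_mono hH (hx_pos (n + 1)) hlt
    rwa [hdiff, mul_div_cancel_right₀ _ hg.ne'] at bounds
  exact ⟨increments,
    liminf_le_liminf_div_natCast (a := fun n => H (x n)) fun n => (increments n).1,
    liminf_le_limsup,
    limsup_div_natCast_le_limsup (a := fun n => H (x n)) fun n => (increments n).2⟩
end

section
/- Let 1 < q < ∞ and let (x_n) and (δ_n) be sequences of strictly positive real numbers such that δ_n → δ_∞ for some δ_∞ > 0, x_n/x_{n+1} → 1, and x_n = x_{n+1} + δ_n·x_{n+1}^q for every n. Then x_n → 0, the convergence is logarithmic, i.e. x_{n+1}/x_n → 1 and (x_{n+1} − x_{n+2})/(x_n − x_{n+1}) → 1, and moreover n^{1/(q−1)}·x_n → ((q−1)·δ_∞)^{−1/(q−1)}. -/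
open Filter

/-- If the increments of a real sequence converge to `c`, then so does `y n / n`. -/
theorem tendsto_div_nat_of_tendsto_sub {y : ℕ → ℝ} {c : ℝ}
    (h : Tendsto (fun n => y (n + 1) - y n) atTop (nhds c)) :
    Tendsto (fun n : ℕ => y n / n) atTop (nhds c) := by
  have h1 := h.cesaro
  have h2 : Tendsto (fun n : ℕ => y 0 / (n : ℝ)) atTop (nhds 0) :=
    tendsto_const_div_atTop_nhds_zero_nat _
  have h3 := h1.add h2
  rw [add_zero] at h3
  refine h3.congr fun n => ?_
  rw [Finset.sum_range_sub]
  ring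

/-- The difference quotients of `t ↦ t ^ p` at `1` along a sequence tending to `1`. -/
theorem tendsto_rpow_sub_one_div_sub_one {r : ℕ → ℝ} (p : ℝ)
    (hr : Tendsto r atTop (nhds 1)) (hr1 : ∀ n, r n ≠ 1) :
    Tendsto (fun n => (r n ^ p - 1) / (r n - 1)) atTop (nhds p) := by
  have h1 : HasDerivAt (fun t : ℝ => t ^ p) (p * 1 ^ (p - 1)) 1 :=
    Real.hasDerivAt_rpow_const (Or.inl one_ne_zero)
  rw [Real.one_rpow, mul_one, hasDerivAt_iff_tendsto_slope] at h1
  have h2 : Tendsto r atTop (nhdsWithin 1 {1}ᶜ) :=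
    tendsto_nhdsWithin_iff.2 ⟨hr, Eventually.of_forall hr1⟩
  refine (h1.comp h2).congr fun n => ?_
  simp [slope_def_field]

theorem example_log_rate (q : ℝ) (hq : 1 < q)
    (x δ : ℕ → ℝ) (δ_inf : ℝ)
    (hx_pos : ∀ n, 0 < x n) (hδ_pos : ∀ n, 0 < δ n)
    (hδ_inf : 0 < δ_inf)
    (hδ_lim : Tendsto δ atTop (nhds δ_inf))
    (hratio : Tendsto (fun n => x n / x (n + 1)) atTop (nhds 1))
    (hrec : ∀ n, x n = x (n + 1) + δ n * x (n + 1) ^ q) :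
    Tendsto x atTop (nhds 0) ∧
    Tendsto (fun n => x (n + 1) / x n) atTop (nhds 1) ∧
    Tendsto (fun n => (x (n + 1) - x (n + 2)) / (x n - x (n + 1))) atTop (nhds 1) ∧
    Tendsto (fun n : ℕ => (n : ℝ) ^ (1 / (q - 1)) * x n) atTop
      (nhds (((q - 1) * δ_inf) ^ (-(1 / (q - 1))))) := by
  have hq1 : 0 < q - 1 := sub_pos.2 hq
  have hpow : ∀ n, 0 < x n ^ q := fun n => Real.rpow_pos_of_pos (hx_pos n) q
  have hdiff : ∀ n, x n - x (n + 1) = δ n * x (n + 1) ^ q := fun n => by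
    linarith [hrec n]
  have hanti : Antitone x := antitone_nat_of_succ_le fun n => by
    linarith [hrec n, mul_pos (hδ_pos n) (hpow (n + 1))]
  have hinv : Tendsto (fun n => x (n + 1) / x n) atTop (nhds 1) := by
    simpa using hratio.inv₀ one_ne_zero
  refine ⟨?_, hinv, ?_, ?_⟩
  · have hbdd : BddBelow (Set.range x) := ⟨0, by rintro _ ⟨n, rfl⟩; exact (hx_pos n).le⟩
    have hL := tendsto_atTop_ciInf hanti hbdd
    have hL0 : 0 ≤ ⨅ n, x n := le_ciInf fun n => (hx_pos n).le
    generalize (⨅ n, x n) = L at hL hL0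
    have hL1 := (tendsto_add_atTop_iff_nat 1).2 hL
    have h1 : Tendsto (fun n => δ n * x (n + 1) ^ q) atTop (nhds (δ_inf * L ^ q)) :=
      hδ_lim.mul (hL1.rpow_const (Or.inr (by linarith)))
    have h2 : Tendsto (fun n => δ n * x (n + 1) ^ q) atTop (nhds (L - L)) :=
      (hL.sub hL1).congr hdiff
    have h3 := tendsto_nhds_unique h1 h2
    rcases hL0.eq_or_lt with h | h
    · rwa [← h] at hL
    · have := mul_pos hδ_inf (Real.rpow_pos_of_pos h q)
      linarith
  · have h1 : Tendsto (fun n => δ (n + 1) / δ n) atTop (nhds (δ_inf / δ_inf)) :=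
      ((tendsto_add_atTop_iff_nat 1).2 hδ_lim).div hδ_lim hδ_inf.ne'
    have h2 := ((tendsto_add_atTop_iff_nat 1).2 hinv).rpow_const (p := q)
      (Or.inl one_ne_zero)
    have h3 := h1.mul h2
    rw [div_self hδ_inf.ne', Real.one_rpow, one_mul] at h3
    refine h3.congr fun n => ?_
    rw [hdiff n, hdiff (n + 1), Real.div_rpow (hx_pos _).le (hx_pos _).le,
      div_mul_div_comm]
  · have hr : ∀ n, x n / x (n + 1) - 1 = δ n * x (n + 1) ^ (q - 1) := fun n => by
      have := (hx_pos (n + 1)).ne'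
      rw [Real.rpow_sub_one this, div_sub_one this, hdiff n, mul_div_assoc]
    have hr1 : ∀ n, x n / x (n + 1) ≠ 1 := fun n h => by
      have := hr n
      rw [h, sub_self] at this
      exact (mul_pos (hδ_pos n) (Real.rpow_pos_of_pos (hx_pos (n + 1)) _)).ne this
    have hinc : Tendsto (fun n => x (n + 1) ^ (-(q - 1)) - x n ^ (-(q - 1))) atTop
        (nhds ((q - 1) * δ_inf)) := by
      have h := ((tendsto_rpow_sub_one_div_sub_one (-(q - 1)) hratio hr1).mul hδ_lim).neg
      rw [neg_mul, neg_neg] at h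
      refine h.congr fun n => ?_
      have h1 := (Real.rpow_pos_of_pos (hx_pos (n + 1)) (q - 1)).ne'
      have h2 := (Real.rpow_pos_of_pos (hx_pos n) (q - 1)).ne'
      have h3 := (hδ_pos n).ne'
      rw [hr n, Real.div_rpow (hx_pos _).le (hx_pos _).le, Real.rpow_neg (hx_pos _).le,
        Real.rpow_neg (hx_pos _).le]
      field_simp
      ring
    have hlim := (tendsto_div_nat_of_tendsto_sub (y := fun n => x n ^ (-(q - 1)))
      hinc).rpow_const (p := -(1 / (q - 1))) (Or.inl (mul_pos hq1 hδ_inf).ne')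
    refine hlim.congr fun n => ?_
    rw [Real.div_rpow (Real.rpow_pos_of_pos (hx_pos n) _).le n.cast_nonneg,
      ← Real.rpow_mul (hx_pos n).le, neg_mul_neg, mul_one_div_cancel hq1.ne', Real.rpow_one,
      Real.rpow_neg n.cast_nonneg, div_inv_eq_mul, mul_comm]
end

section
/- Let g : (0,∞) → (0,∞) be increasing and let H be an antiderivative of −1/g. Let (β_n) and (ρ_n) be sequences of strictly positive real numbers with β_{n+1} ≤ β_n − ρ_n·g(β_n) for every n, and suppose ρ̲ := liminf ρ_n > 0. Then for every ε with 0 < ε < ρ̲ there exists m ∈ ℕ such that for all n ≥ m, H(β_n) ≥ n·(ρ̲ − ε) (equivalently, since H is strictly decreasing, β_n ≤ H^{−1}(n·(ρ̲ − ε)) whenever this value is defined). -/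
open Filter

/-- An antiderivative of `-1 / g` with `g` positive and increasing grows by at least `r` when its
argument decreases from `x` by at least `r * g x`. -/
theorem add_le_of_hasDerivAt_neg_one_div {g H : ℝ → ℝ}
    (hg_pos : ∀ x : ℝ, 0 < x → 0 < g x)
    (hg_mono : ∀ x y : ℝ, 0 < x → x ≤ y → g x ≤ g y)
    (hH : ∀ x : ℝ, 0 < x → HasDerivAt H (-1 / g x) x)
    {x y r : ℝ} (hx : 0 < x) (hy : 0 < y) (hr : 0 < r) (hyx : y ≤ x - r * g x) :
    H x + r ≤ H y := by
  have hgx := hg_pos x hx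
  have hlt : y < x := by linarith [mul_pos hr hgx]
  obtain ⟨z, ⟨hyz, hzx⟩, hz⟩ := exists_hasDerivAt_eq_slope H (fun t => -1 / g t) hlt
    (fun t ht => (hH t (hy.trans_le ht.1)).continuousAt.continuousWithinAt)
    (fun t ht => hH t (hy.trans ht.1))
  have hgz := hg_pos z (hy.trans hyz)
  have hle : g z ≤ g x := hg_mono z x (hy.trans hyz) hzx.le
  rw [div_eq_div_iff hgz.ne' (sub_pos.2 hlt).ne'] at hz
  have hmul : r * g z ≤ r * g x := mul_le_mul_of_nonneg_left hle hr.le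
  have hkey : r * g z ≤ (H y - H x) * g z := by linarith
  linarith [le_of_mul_le_mul_right hkey hgz]

/-- A sequence whose increments eventually exceed `d` eventually dominates `n * c` for `c < d`. -/
theorem eventually_natCast_mul_le_of_add_le {u : ℕ → ℝ} {c d : ℝ} (hcd : c < d)
    (hu : ∀ᶠ n in atTop, u n + d ≤ u (n + 1)) : ∀ᶠ n : ℕ in atTop, n * c ≤ u n := by
  obtain ⟨N, hN⟩ := eventually_atTop.1 hu
  have hlin : ∀ n ≥ N, u N + ((n : ℝ) - N) * d ≤ u n := by
    intro n hn
    induction n, hn using Nat.le_induction with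
    | base => simp
    | succ k hk ih =>
      push_cast
      linarith [hN k hk]
  have hlarge := (tendsto_natCast_atTop_atTop (R := ℝ)).eventually_ge_atTop
    ((N * d - u N) / (d - c))
  filter_upwards [hlarge, eventually_ge_atTop N] with n hn hNn
  rw [div_le_iff₀ (sub_pos.2 hcd)] at hn
  linarith [hlin n hNn]

theorem cor_one_sided (g : ℝ → ℝ) (H : ℝ → ℝ)
    (hg_pos : ∀ x : ℝ, 0 < x → 0 < g x)
    (hg_mono : ∀ x y : ℝ, 0 < x → x ≤ y → g x ≤ g y)
    (hH : ∀ x : ℝ, 0 < x → HasDerivAt H (-1 / g x) x)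
    (β ρ : ℕ → ℝ)
    (hβ_pos : ∀ n, 0 < β n) (hρ_pos : ∀ n, 0 < ρ n)
    (hrec : ∀ n, β (n + 1) ≤ β n - ρ n * g (β n))
    (ρlow : ℝ)
    (hρlow : liminf (fun n => ((ρ n : ℝ) : EReal)) atTop = (ρlow : EReal))
    (hρlow_pos : 0 < ρlow) :
    ∀ ε : ℝ, 0 < ε → ε < ρlow →
      ∃ m : ℕ, ∀ n ≥ m, (n : ℝ) * (ρlow - ε) ≤ H (β n) := by
  intro ε hε _
  have hlt : ((ρlow - ε / 2 : ℝ) : EReal) < liminf (fun n => ((ρ n : ℝ) : EReal)) atTop := by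
    rw [hρlow, EReal.coe_lt_coe_iff]
    linarith
  refine eventually_atTop.1 (eventually_natCast_mul_le_of_add_le (u := fun n => H (β n))
    (d := ρlow - ε / 2) (by linarith) ?_)
  filter_upwards [eventually_lt_of_lt_liminf hlt] with n hn
  have hstep := add_le_of_hasDerivAt_neg_one_div hg_pos hg_mono hH (hβ_pos n) (hβ_pos (n + 1))
    (hρ_pos n) (hrec n)
  linarith [EReal.coe_lt_coe_iff.1 hn]
end

section
/- Let 1 ≤ q < ∞ and let (β_n) and (ρ_n) be sequences of strictly positive real numbers with β_{n+1} ≤ β_n − ρ_n·β_n^q for every n, and suppose ρ̲ := liminf ρ_n > 0. Then for every ε with 0 < ε < ρ̲ there exists m ∈ ℕ such that for all n ≥ m: if q > 1 then β_n ≤ ((q−1)·n·(ρ̲ − ε))^{−1/(q−1)}; if q = 1 then β_n ≤ γ^n where γ = exp(ε − ρ̲) ∈ (0,1). -/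
open Filter

/-- If the increments of `u` are eventually at least `d > c`, then eventually `c * n ≤ u n`. -/
lemma exists_forall_mul_le_of_add_le {u : ℕ → ℝ} {c d : ℝ} (hcd : c < d)
    (hu : ∀ᶠ n in atTop, u n + d ≤ u (n + 1)) : ∃ m : ℕ, ∀ n ≥ m, c * n ≤ u n := by
  obtain ⟨N, hN⟩ := eventually_atTop.1 hu
  obtain ⟨M, hM⟩ := exists_nat_ge ((d * N - u N) / (d - c))
  refine ⟨max N M, fun n hn => ?_⟩
  have hlin : ∀ k ≥ N, u N + d * ((k : ℝ) - N) ≤ u k := by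
    intro k hk
    induction k, hk using Nat.le_induction with
    | base => simp
    | succ k hk ih =>
      have := hN k hk
      push_cast
      linarith
  have hMn : (M : ℝ) ≤ n := by exact_mod_cast (le_max_right N M).trans hn
  have hn' := hlin n ((le_max_left N M).trans hn)
  have hdiv := (div_le_iff₀ (sub_pos.2 hcd)).1 (hM.trans hMn)
  linarith

/-- One step of the recursion in the case `q = 1`, on a logarithmic scale. -/
lemma neg_log_add_le_of_le_sub_mul {a b r : ℝ} (ha : 0 < a) (hb : 0 < b)
    (h : b ≤ a - r * a) : -Real.log a + r ≤ -Real.log b := by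
  have h1 : b / a ≤ 1 - r := by
    rw [div_le_iff₀ ha]
    linarith
  have h2 := Real.log_le_sub_one_of_pos (div_pos hb ha)
  rw [Real.log_div hb.ne' ha.ne'] at h2
  linarith

/-- One step of the recursion with exponent `p + 1`, after the substitution `x ↦ x ^ (-p)`. -/
lemma rpow_neg_add_le_of_le_sub_mul_rpow {a b r p : ℝ} (ha : 0 < a) (hb : 0 < b) (hp : 0 < p)
    (h : b ≤ a - r * a ^ (p + 1)) : a ^ (-p) + p * r ≤ b ^ (-p) := by
  have hap : 0 < a ^ p := Real.rpow_pos_of_pos ha p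
  rw [Real.rpow_add_one ha.ne', ← mul_assoc] at h
  have hlog := neg_log_add_le_of_le_sub_mul ha hb h
  have hexp : p * (r * a ^ p) + 1 ≤ Real.exp (p * (Real.log a - Real.log b)) :=
    (Real.add_one_le_exp _).trans' (by nlinarith)
  have hquot : b ^ (-p) = a ^ (-p) * Real.exp (p * (Real.log a - Real.log b)) := by
    rw [Real.rpow_def_of_pos hb, Real.rpow_def_of_pos ha, ← Real.exp_add]
    ring_nf
  have hcancel : a ^ (-p) * a ^ p = 1 := by rw [← Real.rpow_add ha]; simp
  calc a ^ (-p) + p * r = a ^ (-p) * (p * (r * a ^ p) + 1) := by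
        linear_combination (-(p * r)) * hcancel
    _ ≤ b ^ (-p) := by
        rw [hquot]
        gcongr

theorem example_one_sided_power (q : ℝ) (hq : 1 ≤ q)
    (β ρ : ℕ → ℝ)
    (hβ_pos : ∀ n, 0 < β n) (hρ_pos : ∀ n, 0 < ρ n)
    (hrec : ∀ n, β (n + 1) ≤ β n - ρ n * β n ^ q)
    (ρlow : ℝ)
    (hρlow : liminf (fun n => ((ρ n : ℝ) : EReal)) atTop = (ρlow : EReal))
    (hρlow_pos : 0 < ρlow) :
    ∀ ε : ℝ, 0 < ε → ε < ρlow →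
      ∃ m : ℕ, ∀ n ≥ m,
        (1 < q → β n ≤ ((q - 1) * n * (ρlow - ε)) ^ (-(1 / (q - 1)))) ∧
        (q = 1 → β n ≤ Real.exp (ε - ρlow) ^ n) := by
  intro ε hε hερ
  have hρ : ∀ᶠ n in atTop, ρlow - ε / 2 < ρ n := by
    have hlt : ((ρlow - ε / 2 : ℝ) : EReal) < liminf (fun n => ((ρ n : ℝ) : EReal)) atTop := by
      rw [hρlow, EReal.coe_lt_coe_iff]
      linarith
    filter_upwards [eventually_lt_of_lt_liminf hlt] with n hn
    exact EReal.coe_lt_coe_iff.1 hn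
  rcases hq.eq_or_lt with rfl | hq1
  · obtain ⟨m, hm⟩ := exists_forall_mul_le_of_add_le (u := fun n => -Real.log (β n))
      (c := ρlow - ε) (d := ρlow - ε / 2) (by linarith) (by
        filter_upwards [hρ] with n hn
        have := neg_log_add_le_of_le_sub_mul (hβ_pos n) (hβ_pos (n + 1))
          (by simpa using hrec n)
        linarith)
    refine ⟨m, fun n hn => ⟨fun h => absurd h (lt_irrefl _), fun _ => ?_⟩⟩
    rw [← Real.exp_nat_mul, ← Real.log_le_iff_le_exp (hβ_pos n)]
    linarith [hm n hn]
  · have hp : 0 < q - 1 := sub_pos.2 hq1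
    obtain ⟨m, hm⟩ := exists_forall_mul_le_of_add_le (u := fun n => β n ^ (-(q - 1)))
      (c := (q - 1) * (ρlow - ε)) (d := (q - 1) * (ρlow - ε / 2))
      (by gcongr; linarith) (by
        filter_upwards [hρ] with n hn
        have := rpow_neg_add_le_of_le_sub_mul_rpow (hβ_pos n) (hβ_pos (n + 1)) hp
          (by simpa using hrec n)
        nlinarith)
    refine ⟨max m 1, fun n hn => ⟨fun _ => ?_, fun h => absurd h hq1.ne'⟩⟩
    have hn0 : (0 : ℝ) < n := by exact_mod_cast (le_max_right m 1).trans hn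
    have hpos : 0 < (q - 1) * n * (ρlow - ε) := by
      have := sub_pos.2 hερ
      positivity
    have hle : (q - 1) * n * (ρlow - ε) ≤ β n ^ (-(q - 1)) := by
      linarith [hm n ((le_max_left m 1).trans hn)]
    calc β n = (β n ^ (-(q - 1))) ^ (-(1 / (q - 1))) := by
          rw [← Real.rpow_mul (hβ_pos n).le, neg_mul_neg, mul_one_div_cancel hp.ne',
            Real.rpow_one]
      _ ≤ _ := Real.rpow_le_rpow_of_nonpos hpos hle (by
          rw [neg_nonpos]
          positivity)
end

section
/- Let g : (0,∞) → (0,∞) be increasing and let H be an antiderivative of −1/g. Let (β_n) and (ρ_n) be sequences of strictly positive real numbers with β_n ≥ β_{n+1} ≥ β_n − ρ_n·g(β_n) for every n, and suppose ρ̄ := limsup (ρ_n·g(β_n)/g(β_{n+1})) is a finite nonnegative real number. Then for every ε > 0 there exists m ∈ ℕ such that for all n ≥ m, H(β_n) ≤ n·(ρ̄ + ε) (equivalently, since H is strictly decreasing, β_n ≥ H^{−1}(n·(ρ̄ + ε)) whenever this value is defined). -/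
open Filter

/-- An antiderivative of `-1 / g` with `g` increasing increases by at most `(y - x) / g x`
from `y` down to `x`. -/
theorem antideriv_neg_inv_sub_le {g H : ℝ → ℝ}
    (hg_pos : ∀ x : ℝ, 0 < x → 0 < g x)
    (hg_mono : ∀ x y : ℝ, 0 < x → x ≤ y → g x ≤ g y)
    (hH : ∀ x : ℝ, 0 < x → HasDerivAt H (-1 / g x) x)
    {x y : ℝ} (hx : 0 < x) (hxy : x ≤ y) : H x - H y ≤ (y - x) / g x := by
  have key := (convex_Icc x y).mul_sub_le_image_sub_of_le_deriv (f := H) (C := -1 / g x)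
    (fun z hz => (hH z (hx.trans_le hz.1)).continuousAt.continuousWithinAt)
    (fun z hz => (hH z (hx.trans_le
      (interior_subset hz).1)).differentiableAt.differentiableWithinAt)
    (fun z hz => by
      have hz' := interior_subset hz
      rw [(hH z (hx.trans_le hz'.1)).deriv, neg_div, neg_div, neg_le_neg_iff]
      exact one_div_le_one_div_of_le (hg_pos x hx) (hg_mono x z hx hz'.1))
    x (Set.left_mem_Icc.2 hxy) y (Set.right_mem_Icc.2 hxy) hxy
  have e : (y - x) / g x = -(-1 / g x * (y - x)) := by ring
  linarith

/-- A real sequence whose increments are eventually at most `c` is eventually below `n * d`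
for every `d > c`. -/
theorem exists_forall_ge_le_mul_of_eventually_sub_le {u : ℕ → ℝ} {c d : ℝ} (hcd : c < d)
    (hu : ∀ᶠ n in atTop, u (n + 1) - u n ≤ c) : ∃ m : ℕ, ∀ n ≥ m, u n ≤ (n : ℝ) * d := by
  obtain ⟨N, hN⟩ := eventually_atTop.1 hu
  have bound : ∀ n ≥ N, u n ≤ u N + ((n : ℝ) - N) * c := by
    intro n hn
    induction n, hn using Nat.le_induction with
    | base => simp
    | succ n hn ih =>
      have := hN n hn
      push_cast
      linarith
  obtain ⟨M, hM⟩ := exists_nat_ge ((u N - N * c) / (d - c))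
  refine ⟨max N M, fun n hn => ?_⟩
  have hMn : (M : ℝ) ≤ n := by exact_mod_cast (le_max_right N M).trans hn
  have h := (div_le_iff₀ (sub_pos.2 hcd)).1 (hM.trans hMn)
  have := bound n ((le_max_left N M).trans hn)
  linarith

theorem cor_one_sided_lower (g : ℝ → ℝ) (H : ℝ → ℝ)
    (hg_pos : ∀ x : ℝ, 0 < x → 0 < g x)
    (hg_mono : ∀ x y : ℝ, 0 < x → x ≤ y → g x ≤ g y)
    (hH : ∀ x : ℝ, 0 < x → HasDerivAt H (-1 / g x) x)
    (β ρ : ℕ → ℝ)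
    (hβ_pos : ∀ n, 0 < β n) (hρ_pos : ∀ n, 0 < ρ n)
    (hrec : ∀ n, β (n + 1) ≤ β n ∧ β n - ρ n * g (β n) ≤ β (n + 1))
    (ρbar : ℝ)
    (hρbar : limsup (fun n => ((ρ n * g (β n) / g (β (n + 1)) : ℝ) : EReal)) atTop
      = (ρbar : EReal))
    (hρbar_nonneg : 0 ≤ ρbar) :
    ∀ ε : ℝ, 0 < ε →
      ∃ m : ℕ, ∀ n ≥ m, H (β n) ≤ (n : ℝ) * (ρbar + ε) := by
  intro ε hε
  refine exists_forall_ge_le_mul_of_eventually_sub_le (u := fun n => H (β n))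
    (c := ρbar + ε / 2) (by linarith) ?_
  have hlt : limsup (fun n => ((ρ n * g (β n) / g (β (n + 1)) : ℝ) : EReal)) atTop
      < ((ρbar + ε / 2 : ℝ) : EReal) := by
    rw [hρbar]
    exact EReal.coe_lt_coe_iff.2 (by linarith)
  filter_upwards [eventually_lt_of_limsup_lt hlt] with n hn
  obtain ⟨hle, hstep⟩ := hrec n
  calc H (β (n + 1)) - H (β n) ≤ (β n - β (n + 1)) / g (β (n + 1)) :=
        antideriv_neg_inv_sub_le hg_pos hg_mono hH (hβ_pos (n + 1)) hle
    _ ≤ ρ n * g (β n) / g (β (n + 1)) :=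
        div_le_div_of_nonneg_right (by linarith) (hg_pos _ (hβ_pos (n + 1))).le
    _ ≤ ρbar + ε / 2 := (EReal.coe_lt_coe_iff.1 hn).le
end

section
/- Let f : ℝ → ℝ be convex and even with f(0) = 0 and f(x) > 0 for all x ≠ 0, and set s := inf { f(t)/t : t > 0 } (the right derivative of f at 0). Then: (a) for every x > 0, the unique minimizer p of y ↦ f(y) + ½(x − y)² satisfies p = 0 if and only if x ≤ s; and (b) every proximal point sequence, i.e. every sequence (x_n) with x_0 > 0 and x_{n+1} the unique minimizer of y ↦ f(y) + ½(x_n − y)² for each n, reaches 0 in finitely many steps (for every choice of x_0 > 0) if and only if s > 0. -/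
open Filter

lemma le_of_forall_le_add_mul_sq {a b c : ℝ}
    (h : ∀ e : ℝ, 0 < e → e ≤ 1 → a ≤ b + e * c ^ 2 / 2) : a ≤ b := by
  refine le_of_forall_pos_le_add fun d hd => ?_
  have hq : 0 < c ^ 2 + 1 := by positivity
  have he : 0 < min 1 (d / (c ^ 2 + 1)) := by positivity
  have hle := h _ he (min_le_left _ _)
  have hd' : min 1 (d / (c ^ 2 + 1)) * (c ^ 2 + 1) ≤ d :=
    (le_div_iff₀ hq).1 (min_le_right _ _)
  nlinarith [mul_nonneg he.le (sq_nonneg c)]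

/-- Shrinking the argument of a convex function vanishing at `0`. -/
lemma ConvexOn.map_mul_le_of_map_zero {f : ℝ → ℝ} (hconv : ConvexOn ℝ Set.univ f)
    (hf0 : f 0 = 0) {l : ℝ} (hl0 : 0 ≤ l) (hl1 : l ≤ 1) (t : ℝ) : f (l * t) ≤ l * f t := by
  have h := hconv.2 (Set.mem_univ t) (Set.mem_univ 0) hl0 (sub_nonneg.2 hl1) (by ring)
  simpa [hf0] using h

/-- A nonnegative convex function on the line that vanishes at `0` has a proximal point
everywhere. -/
lemma ConvexOn.exists_proximal_point {f : ℝ → ℝ} (hconv : ConvexOn ℝ Set.univ f)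
    (hf0 : f 0 = 0) (hnn : ∀ x, 0 ≤ f x) (x : ℝ) :
    ∃ p, ∀ y, f p + (x - p) ^ 2 / 2 ≤ f y + (x - y) ^ 2 / 2 := by
  have hcont : ContinuousOn f Set.univ := hconv.continuousOn isOpen_univ
  have hf : Continuous f := continuousOn_univ.1 hcont
  have h0 : (0 : ℝ) ∈ Set.Icc (x - |x|) (x + |x|) :=
    ⟨by linarith [le_abs_self x], by linarith [neg_abs_le x]⟩
  obtain ⟨p, -, hp⟩ := (isCompact_Icc (a := x - |x|) (b := x + |x|)).exists_isMinOn ⟨0, h0⟩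
    (f := fun y => f y + (x - y) ^ 2 / 2) (by fun_prop)
  refine ⟨p, fun y => ?_⟩
  by_cases hy : y ∈ Set.Icc (x - |x|) (x + |x|)
  · exact hp hy
  · have h1 : f p + (x - p) ^ 2 / 2 ≤ f 0 + (x - 0) ^ 2 / 2 := hp h0
    have h2 : |x| ≤ |x - y| := by
      by_contra! h
      obtain ⟨ha, hb⟩ := abs_lt.1 h
      exact hy ⟨by linarith, by linarith⟩
    have h3 := sq_le_sq.2 h2
    rw [hf0, sub_zero] at h1
    linarith [hnn y]

/-- The optimality condition of the proximal point, tested against `0`. -/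
lemma ConvexOn.map_proximal_point_le {f : ℝ → ℝ} (hconv : ConvexOn ℝ Set.univ f)
    (hf0 : f 0 = 0) {x p : ℝ}
    (hp : ∀ y, f p + (x - p) ^ 2 / 2 ≤ f y + (x - y) ^ 2 / 2) : f p ≤ p * (x - p) := by
  refine le_of_forall_le_add_mul_sq (c := p) fun e he he1 => ?_
  have h1 := hp ((1 - e) * p)
  have h2 := hconv.map_mul_le_of_map_zero hf0 (l := 1 - e) (by linarith) (by linarith) p
  refine le_of_mul_le_mul_left ?_ he
  nlinarith

/-- If `0` is the proximal point at `x`, then `x` is a subgradient at `0`. -/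
lemma ConvexOn.mul_le_of_proximal_point_zero {f : ℝ → ℝ} (hconv : ConvexOn ℝ Set.univ f)
    (hf0 : f 0 = 0) {x : ℝ} (hp : ∀ y, x ^ 2 / 2 ≤ f y + (x - y) ^ 2 / 2) (t : ℝ) :
    x * t ≤ f t := by
  refine le_of_forall_le_add_mul_sq (c := t) fun e he he1 => ?_
  have h1 := hp (e * t)
  have h2 := hconv.map_mul_le_of_map_zero hf0 he.le he1 t
  refine le_of_mul_le_mul_left ?_ he
  nlinarith

theorem ppa_finite_convergence (f : ℝ → ℝ)
    (hconv : ConvexOn ℝ Set.univ f)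
    (heven : ∀ x : ℝ, f (-x) = f x)
    (hf0 : f 0 = 0)
    (hfpos : ∀ x : ℝ, x ≠ 0 → 0 < f x)
    (s : ℝ) (hs : s = sInf {r : ℝ | ∃ t : ℝ, 0 < t ∧ r = f t / t}) :
    (∀ x : ℝ, 0 < x → ∀ p : ℝ,
      (∀ y : ℝ, f p + (x - p) ^ 2 / 2 ≤ f y + (x - y) ^ 2 / 2) →
      (p = 0 ↔ x ≤ s)) ∧
    ((∀ x : ℕ → ℝ, 0 < x 0 →
        (∀ n : ℕ, ∀ y : ℝ,
          f (x (n + 1)) + (x n - x (n + 1)) ^ 2 / 2 ≤ f y + (x n - y) ^ 2 / 2) →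
        ∃ n : ℕ, x n = 0) ↔ 0 < s) := by
  have hnn : ∀ x, 0 ≤ f x := fun x => by
    rcases eq_or_ne x 0 with rfl | h
    · exact hf0.ge
    · exact (hfpos x h).le
  have hslope : ∀ t : ℝ, 0 < t → s * t ≤ f t := by
    intro t ht
    rw [← le_div_iff₀ ht, hs]
    refine csInf_le ⟨0, ?_⟩ ⟨t, ht, rfl⟩
    rintro r ⟨u, hu, rfl⟩
    exact div_nonneg (hnn u) hu.le
  have hnonneg : ∀ x : ℝ, 0 < x → ∀ p : ℝ,
      (∀ y : ℝ, f p + (x - p) ^ 2 / 2 ≤ f y + (x - y) ^ 2 / 2) → 0 ≤ p := by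
    intro x hx p hp
    have h := hp (-p)
    rw [heven] at h
    by_contra! hlt
    nlinarith
  have hzero : ∀ x : ℝ, 0 < x → ∀ p : ℝ,
      (∀ y : ℝ, f p + (x - p) ^ 2 / 2 ≤ f y + (x - y) ^ 2 / 2) → (p = 0 ↔ x ≤ s) := by
    intro x hx p hp
    constructor
    · rintro rfl
      rw [hs]
      refine le_csInf ⟨f 1 / 1, 1, one_pos, rfl⟩ ?_
      rintro r ⟨t, ht, rfl⟩
      rw [le_div_iff₀ ht]
      exact hconv.mul_le_of_proximal_point_zero hf0 (by simpa [hf0] using hp) t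
    · intro hxs
      by_contra hne
      have hpos : 0 < p := lt_of_le_of_ne (hnonneg x hx p hp) (Ne.symm hne)
      have h1 := hconv.map_proximal_point_le hf0 hp
      nlinarith [hslope p hpos]
  refine ⟨hzero, fun hfin => ?_, fun hspos x hx0 hx => ?_⟩
  · by_contra! hs0
    choose P hP using hconv.exists_proximal_point hf0 hnn
    let x : ℕ → ℝ := fun n => P^[n] 1
    have hstep : ∀ n, x (n + 1) = P (x n) := fun n => Function.iterate_succ_apply' P n 1
    have hxpos : ∀ n, 0 < x n := by
      intro n
      induction n with
      | zero => exact one_pos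
      | succ n ih =>
        rw [hstep]
        refine lt_of_le_of_ne (hnonneg _ ih _ (hP _)) fun h => ?_
        linarith [(hzero _ ih _ (hP _)).1 h.symm]
    obtain ⟨n, hn⟩ := hfin x (hxpos 0) fun n => by
      rw [hstep]
      exact hP (x n)
    exact (hxpos n).ne' hn
  · by_contra! hne
    have hbound : ∀ n : ℕ, 0 < x n ∧ x n ≤ x 0 - n * s := by
      intro n
      induction n with
      | zero => simpa using hx0
      | succ n ih =>
        have hpos : 0 < x (n + 1) :=
          lt_of_le_of_ne (hnonneg _ ih.1 _ (hx n)) (hne (n + 1)).symm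
        have h1 := (hslope _ hpos).trans (hconv.map_proximal_point_le hf0 (hx n))
        rw [mul_comm] at h1
        have h2 := le_of_mul_le_mul_left h1 hpos
        refine ⟨hpos, ?_⟩
        push_cast
        linarith [ih.2]
    obtain ⟨n, hn⟩ := exists_nat_gt (x 0 / s)
    rw [div_lt_iff₀ hspos] at hn
    linarith [hbound n]
end

section
/- Let 1 < q < 2 and let (x_n) be a sequence of strictly positive real numbers satisfying x_n = x_{n+1} + q·x_{n+1}^{q−1} for every n. Then x_n → 0, the sequence (x_{n+1}/x_n^{1/(q−1)}) is increasing and bounded above by q^{1/(1−q)}, and it converges to some μ > 0; in particular x_n → 0 superlinearly with order 1/(q−1). -/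
open Filter

/-- If `x = y + q * y ^ (q - 1)`, then `y / x ^ (1 / (q - 1))` is a function of `y` alone, without
singularity at `y = 0`. -/
lemma ppa_ratio_eq {q y : ℝ} (hq1 : 1 < q) (hy : 0 < y) :
    y / (y + q * y ^ (q - 1)) ^ (1 / (q - 1)) = (q + y ^ (2 - q)) ^ (1 / (1 - q)) := by
  have hp : q - 1 ≠ 0 := by linarith
  have hz : 0 < q + y ^ (2 - q) := by positivity
  have hx : y + q * y ^ (q - 1) = y ^ (q - 1) * (q + y ^ (2 - q)) := by
    have h : y ^ (q - 1) * y ^ (2 - q) = y := by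
      rw [← Real.rpow_add hy]
      ring_nf
      exact Real.rpow_one y
    linear_combination -h
  have hexp : 1 / (1 - q) = -(1 / (q - 1)) := by
    rw [← neg_sub q 1, div_neg]
  rw [hx, Real.mul_rpow (by positivity) hz.le, ← Real.rpow_mul hy.le, mul_one_div_cancel hp,
    Real.rpow_one, hexp, Real.rpow_neg hz.le]
  field_simp

lemma ppa_antitone {q : ℝ} (hq : 0 ≤ q) {x : ℕ → ℝ} (hx_pos : ∀ n, 0 < x n)
    (hrec : ∀ n, x n = x (n + 1) + q * x (n + 1) ^ (q - 1)) : Antitone x := by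
  refine antitone_nat_of_succ_le fun n => ?_
  rw [hrec n]
  have := (hx_pos (n + 1)).le
  exact le_add_of_nonneg_right (by positivity)

lemma ppa_tendsto_zero {q : ℝ} (hq1 : 1 < q) {x : ℕ → ℝ} (hx_pos : ∀ n, 0 < x n)
    (hrec : ∀ n, x n = x (n + 1) + q * x (n + 1) ^ (q - 1)) : Tendsto x atTop (nhds 0) := by
  have hbdd : BddBelow (Set.range x) := ⟨0, by rintro _ ⟨n, rfl⟩; exact (hx_pos n).le⟩
  have hL := tendsto_atTop_ciInf (ppa_antitone (by linarith) hx_pos hrec) hbdd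
  set L := ⨅ n, x n
  have hL0 : 0 ≤ L := ge_of_tendsto' hL fun n => (hx_pos n).le
  have hL1 := hL.comp (tendsto_add_atTop_nat 1)
  have hlim : Tendsto x atTop (nhds (L + q * L ^ (q - 1))) :=
    (hL1.add ((hL1.rpow_const (Or.inr (by linarith))).const_mul q)).congr fun n => (hrec n).symm
  have heq := tendsto_nhds_unique hL hlim
  have hpow : L ^ (q - 1) = 0 := by
    have : q * L ^ (q - 1) = 0 := by linarith
    exact (mul_eq_zero.mp this).resolve_left (by linarith)
  rwa [(Real.rpow_eq_zero hL0 (by linarith)).mp hpow] at hL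

theorem ppa_superlinear (q : ℝ) (hq1 : 1 < q) (hq2 : q < 2)
    (x : ℕ → ℝ) (hx_pos : ∀ n, 0 < x n)
    (hrec : ∀ n, x n = x (n + 1) + q * x (n + 1) ^ (q - 1)) :
    Tendsto x atTop (nhds 0) ∧
    Monotone (fun n => x (n + 1) / x n ^ (1 / (q - 1))) ∧
    (∀ n, x (n + 1) / x n ^ (1 / (q - 1)) ≤ q ^ (1 / (1 - q))) ∧
    ∃ μ : ℝ, 0 < μ ∧
      Tendsto (fun n => x (n + 1) / x n ^ (1 / (q - 1))) atTop (nhds μ) := by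
  have hq0 : 0 < q := by linarith
  have hzero := ppa_tendsto_zero hq1 hx_pos hrec
  have hexp : 1 / (1 - q) ≤ 0 := one_div_nonpos.mpr (by linarith)
  have hratio : ∀ n, x (n + 1) / x n ^ (1 / (q - 1)) =
      (q + x (n + 1) ^ (2 - q)) ^ (1 / (1 - q)) := fun n => by
    rw [hrec n, ppa_ratio_eq hq1 (hx_pos (n + 1))]
  simp only [hratio]
  refine ⟨hzero, fun m n hmn => ?_, fun n => ?_, q ^ (1 / (1 - q)), by positivity, ?_⟩
  · have hn := hx_pos (n + 1)
    have hle := ppa_antitone hq0.le hx_pos hrec (Nat.add_le_add_right hmn 1)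
    refine Real.rpow_le_rpow_of_nonpos (by positivity) ?_ hexp
    gcongr
  · have hn := hx_pos (n + 1)
    exact Real.rpow_le_rpow_of_nonpos hq0 (le_add_of_nonneg_right (by positivity)) hexp
  · have hpow : Tendsto (fun n => x (n + 1) ^ (2 - q)) atTop (nhds 0) := by
      have := (hzero.comp (tendsto_add_atTop_nat 1)).rpow_const (p := 2 - q)
        (Or.inr (by linarith))
      rwa [Real.zero_rpow (by linarith)] at this
    have hsum := hpow.const_add q
    rw [add_zero] at hsum
    exact hsum.rpow_const (Or.inl hq0.ne')
end

section
/- Let 2 < q < ∞ and let (x_n) be a sequence of strictly positive real numbers satisfying x_n = x_{n+1} + q·x_{n+1}^{q−1} for every n, with x_n → 0. Then x_n/x_{n+1} → 1, the convergence of x_n to 0 is logarithmic, and n^{1/(q−2)}·x_n → ((q−2)·q)^{−1/(q−2)}. -/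
open Filter

/-- If the increments of a real sequence tend to `c`, then `u n / n` tends to `c`. -/
lemma tendsto_inv_mul_of_tendsto_sub {u : ℕ → ℝ} {c : ℝ}
    (h : Tendsto (fun n => u (n + 1) - u n) atTop (nhds c)) :
    Tendsto (fun n : ℕ => (n : ℝ)⁻¹ * u n) atTop (nhds c) := by
  have h1 := h.cesaro
  simp only [Finset.sum_range_sub] at h1
  have h2 : Tendsto (fun n : ℕ => (n : ℝ)⁻¹ * u 0) atTop (nhds 0) := by
    simpa using (tendsto_inv_atTop_nhds_zero_nat (𝕜 := ℝ)).mul_const (u 0)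
  simpa [mul_sub] using h1.add h2

/-- The difference quotient of `t ↦ (1 + t) ^ (-r)` at `0` along a positive null sequence. -/
lemma tendsto_one_sub_rpow_neg_div {t : ℕ → ℝ} (r : ℝ) (ht_pos : ∀ n, 0 < t n)
    (ht : Tendsto t atTop (nhds 0)) :
    Tendsto (fun n => (1 - (1 + t n) ^ (-r)) / t n) atTop (nhds r) := by
  have hd : HasDerivAt (fun s : ℝ => s ^ (-r)) (-r) 1 := by
    simpa using Real.hasDerivAt_rpow_const (x := 1) (p := -r) (Or.inl one_ne_zero)
  have ht' : Tendsto t atTop (nhdsWithin 0 {0}ᶜ) :=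
    tendsto_nhdsWithin_iff.2 ⟨ht, Eventually.of_forall fun n => (ht_pos n).ne'⟩
  have h := (hd.tendsto_slope_zero.comp ht').neg
  rw [neg_neg] at h
  refine h.congr fun n => ?_
  simp only [Function.comp_apply, Real.one_rpow, smul_eq_mul]
  ring

theorem ppa_logarithmic (q : ℝ) (hq : 2 < q)
    (x : ℕ → ℝ) (hx_pos : ∀ n, 0 < x n)
    (hrec : ∀ n, x n = x (n + 1) + q * x (n + 1) ^ (q - 1))
    (hx_lim : Tendsto x atTop (nhds 0)) :
    Tendsto (fun n => x n / x (n + 1)) atTop (nhds 1) ∧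
    Tendsto (fun n => x (n + 1) / x n) atTop (nhds 1) ∧
    Tendsto (fun n => (x (n + 1) - x (n + 2)) / (x n - x (n + 1))) atTop (nhds 1) ∧
    Tendsto (fun n : ℕ => (n : ℝ) ^ (1 / (q - 2)) * x n) atTop
      (nhds (((q - 2) * q) ^ (-(1 / (q - 2))))) := by
  have hr : 0 < q - 2 := by linarith
  have hq0 : 0 < q := by linarith
  set t : ℕ → ℝ := fun n => q * x (n + 1) ^ (q - 2) with ht_def
  have ht_pos : ∀ n, 0 < t n := fun n => mul_pos hq0 (Real.rpow_pos_of_pos (hx_pos _) _)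
  have hx_succ : Tendsto (fun n => x (n + 1)) atTop (nhds 0) :=
    hx_lim.comp (tendsto_add_atTop_nat 1)
  have ht : Tendsto t atTop (nhds 0) := by
    have h := (hx_succ.rpow_const (p := q - 2) (Or.inr hr.le)).const_mul q
    simpa [Real.zero_rpow hr.ne'] using h
  have hstep : ∀ n, x n = x (n + 1) * (1 + t n) := fun n => by
    have h : x (n + 1) ^ (q - 1) = x (n + 1) ^ (q - 2) * x (n + 1) := by
      rw [← Real.rpow_add_one (hx_pos _).ne']
      congr 1
      ring
    rw [hrec n, h]
    ring
  have hratio : Tendsto (fun n => x n / x (n + 1)) atTop (nhds 1) := by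
    have h : Tendsto (fun n => 1 + t n) atTop (nhds 1) := by simpa using ht.const_add 1
    refine h.congr fun n => ?_
    rw [hstep n, mul_div_cancel_left₀ _ (hx_pos _).ne']
  have hratio' : Tendsto (fun n => x (n + 1) / x n) atTop (nhds 1) := by
    simpa using hratio.inv₀ one_ne_zero
  refine ⟨hratio, hratio', ?_, ?_⟩
  · have h := (hratio'.comp (tendsto_add_atTop_nat 1)).rpow_const (p := q - 1)
      (Or.inl one_ne_zero)
    rw [Real.one_rpow] at h
    refine h.congr fun n => ?_
    have h1 : x n - x (n + 1) = q * x (n + 1) ^ (q - 1) := by linarith [hrec n]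
    have h2 : x (n + 1) - x (n + 2) = q * x (n + 2) ^ (q - 1) := by linarith [hrec (n + 1)]
    rw [h1, h2, mul_div_mul_left _ _ hq0.ne', ← Real.div_rpow (hx_pos _).le (hx_pos _).le]
    rfl
  · have hincr : Tendsto (fun n => x (n + 1) ^ (-(q - 2)) - x n ^ (-(q - 2))) atTop
        (nhds ((q - 2) * q)) := by
      refine ((tendsto_one_sub_rpow_neg_div (q - 2) ht_pos ht).mul_const q).congr fun n => ?_
      have hpow : x (n + 1) ^ (q - 2) ≠ 0 := (Real.rpow_pos_of_pos (hx_pos _) _).ne'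
      have hx_neg : x n ^ (-(q - 2)) = (x (n + 1) ^ (q - 2))⁻¹ * (1 + t n) ^ (-(q - 2)) := by
        rw [hstep n, Real.mul_rpow (hx_pos _).le (by linarith [ht_pos n]),
          Real.rpow_neg (hx_pos _).le]
      rw [hx_neg, Real.rpow_neg (hx_pos (n + 1)).le]
      generalize (1 + t n) ^ (-(q - 2)) = a
      simp only [ht_def]
      field_simp
    have h := (tendsto_inv_mul_of_tendsto_sub (u := fun n => x n ^ (-(q - 2))) hincr).rpow_const
      (p := -(1 / (q - 2)))
      (Or.inl (mul_pos hr hq0).ne')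
    refine h.congr fun n => ?_
    have hn : (0 : ℝ) ≤ n := n.cast_nonneg
    rw [Real.mul_rpow (inv_nonneg.2 hn) (Real.rpow_nonneg (hx_pos n).le _),
      Real.inv_rpow hn, Real.rpow_neg hn, inv_inv, ← Real.rpow_mul (hx_pos n).le,
      neg_mul_neg, mul_one_div_cancel hr.ne', Real.rpow_one]
end

section
/- Let f : ℝ → ℝ be convex and even with f(0) = 0, f(x) > 0 for all x ≠ 0, and f differentiable at 0 (so f'(0) = 0). Let B = epi f = {(z, s) ∈ ℝ² : f(z) ≤ s} and let (x, r) ∈ ℝ² with r < f(x). Suppose y ∈ ℝ is such that (y, f(y)) is a nearest point of B to (x, r), i.e. (x − y)² + (r − f(y))² ≤ (x − z)² + (r − s)² for every (z, s) ∈ B. Then: if x = 0 then y = 0; if x ≠ 0 then y lies strictly between 0 and x; and x² + r² ≥ y² + f(y)² + (x − y)² + (r − f(y))². -/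
open Filter

/-- The obtuse-angle criterion for a nearest point of the epigraph of a convex function. -/
theorem ConvexOn.inner_sub_nonpos_of_nearest_epigraph {f : ℝ → ℝ}
    (hconv : ConvexOn ℝ Set.univ f) {x r y : ℝ}
    (hproj : ∀ z s : ℝ, f z ≤ s →
      (x - y) ^ 2 + (r - f y) ^ 2 ≤ (x - z) ^ 2 + (r - s) ^ 2)
    {z s : ℝ} (hz : f z ≤ s) :
    (x - y) * (z - y) + (r - f y) * (s - f y) ≤ 0 := by
  by_contra! hpos
  set P := (x - y) * (z - y) + (r - f y) * (s - f y)
  set Q := (z - y) ^ 2 + (s - f y) ^ 2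
  have hQ : 0 ≤ Q := by positivity
  have hden : 0 < P + Q := by linarith
  set t := P / (P + Q)
  have ht0 : 0 < t := div_pos hpos hden
  have ht1 : t ≤ 1 := (div_le_one hden).2 (by linarith)
  have htP : t * (P + Q) = P := div_mul_cancel₀ _ hden.ne'
  have hmem : f ((1 - t) * y + t * z) ≤ (1 - t) * f y + t * s := by
    have h := hconv.2 (Set.mem_univ y) (Set.mem_univ z) (sub_nonneg.2 ht1) ht0.le
      (sub_add_cancel 1 t)
    simp only [smul_eq_mul] at h
    linarith [mul_le_mul_of_nonneg_left hz ht0.le]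
  have hle := hproj _ _ hmem
  have hexp : (x - ((1 - t) * y + t * z)) ^ 2 + (r - ((1 - t) * f y + t * s)) ^ 2 =
      (x - y) ^ 2 + (r - f y) ^ 2 - t * (2 * P - t * Q) := by
    simp only [P, Q]
    ring
  have hgain : 0 < t * (2 * P - t * Q) := by
    apply mul_pos ht0
    linarith [mul_pos ht0 hpos]
  linarith

theorem epigraph_projection (f : ℝ → ℝ)
    (hconv : ConvexOn ℝ Set.univ f)
    (heven : ∀ x : ℝ, f (-x) = f x)
    (hf0 : f 0 = 0)
    (hfpos : ∀ x : ℝ, x ≠ 0 → 0 < f x)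
    (hdiff : HasDerivAt f 0 0)
    (x r y : ℝ) (hr : r < f x)
    (hproj : ∀ z s : ℝ, f z ≤ s →
      (x - y) ^ 2 + (r - f y) ^ 2 ≤ (x - z) ^ 2 + (r - s) ^ 2) :
    (x = 0 → y = 0) ∧
    (0 < x → 0 < y ∧ y < x) ∧
    (x < 0 → x < y ∧ y < 0) ∧
    y ^ 2 + f y ^ 2 + (x - y) ^ 2 + (r - f y) ^ 2 ≤ x ^ 2 + r ^ 2 := by
  have hvar : ∀ z s : ℝ, f z ≤ s → (x - y) * (z - y) + (r - f y) * (s - f y) ≤ 0 :=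
    fun _ _ hz => hconv.inner_sub_nonpos_of_nearest_epigraph hproj hz
  have hzero := hvar 0 0 hf0.le
  have hry : r ≤ f y := by linarith [hvar y (f y + 1) (by linarith)]
  have hfnn : 0 ≤ f y := by
    rcases eq_or_ne y 0 with rfl | hy
    · exact hf0.ge
    · exact (hfpos y hy).le
  have hprod : 0 ≤ f y * (f y - r) := mul_nonneg hfnn (sub_nonneg.2 hry)
  have hxy : 0 ≤ y * (x - y) := by linarith
  have hne_zero : x ≠ 0 → y ≠ 0 := by
    rintro hx rfl
    have hmax : IsLocalMax (fun z => x * z + r * f z) 0 :=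
      Eventually.of_forall fun z => by
        simpa [hf0] using hvar z (f z) le_rfl
    have hder : HasDerivAt (fun z => x * z + r * f z) x 0 := by
      simpa using ((hasDerivAt_id' (0 : ℝ)).const_mul x).fun_add (hdiff.const_mul r)
    exact hx (hmax.hasDerivAt_eq_zero hder)
  have hne : x ≠ 0 → y ≠ x := by
    rintro hx rfl
    linarith [mul_pos (hfpos y hx) (sub_pos.2 hr)]
  refine ⟨fun hx => ?_, fun hx => ?_, fun hx => ?_, by linarith⟩
  · subst hx
    nlinarith
  · have hy : 0 < y := (hne_zero hx.ne').symm.lt_of_le (by nlinarith)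
    exact ⟨hy, (hne hx.ne').lt_of_le (by nlinarith)⟩
  · have hy : y < 0 := (hne_zero hx.ne).lt_of_le (by nlinarith)
    exact ⟨(hne hx.ne).symm.lt_of_le (by nlinarith), hy⟩
end

section
/- Let f : ℝ → ℝ be convex and even with f(0) = 0, f(x) > 0 for all x ≠ 0, and f differentiable at 0 with f'(0) = 0. Let (x_n) be a sequence of strictly positive real numbers with x_n → 0 such that for every n there exists a subgradient s_{n+1} of f at x_{n+1} with x_n = x_{n+1} + f(x_{n+1})·s_{n+1}. Then x_{n+1}/x_n → 1, i.e. the convergence of (x_n) to 0 is sublinear. -/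
open Filter

theorem map_sublinear (f : ℝ → ℝ)
    (hconv : ConvexOn ℝ Set.univ f)
    (heven : ∀ x : ℝ, f (-x) = f x)
    (hf0 : f 0 = 0)
    (hfpos : ∀ x : ℝ, x ≠ 0 → 0 < f x)
    (hdiff : HasDerivAt f 0 0)
    (x : ℕ → ℝ) (hx_pos : ∀ n, 0 < x n)
    (hx_lim : Tendsto x atTop (nhds 0))
    (hrec : ∀ n : ℕ, ∃ s : ℝ,
      (∀ z : ℝ, f (x (n + 1)) + s * (z - x (n + 1)) ≤ f z) ∧
      x n = x (n + 1) + f (x (n + 1)) * s) :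
    Tendsto (fun n => x (n + 1) / x n) atTop (nhds 1) := by
  have slope_tendsto (u : ℕ → ℝ) (hu : ∀ n, 0 < u n) (hlim : Tendsto u atTop (nhds 0)) :
      Tendsto (fun n => f (u n) / u n) atTop (nhds 0) := by
    have h := hasDerivAt_iff_tendsto_slope_zero.1 hdiff
    have h' := h.comp (tendsto_nhdsWithin_iff.2
      ⟨hlim, Eventually.of_forall fun n => (hu n).ne'⟩)
    refine h'.congr fun n => ?_
    simp [hf0, div_eq_inv_mul]
  have hlim : Tendsto (fun n => x (n + 1)) atTop (nhds 0) :=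
    hx_lim.comp (tendsto_add_atTop_nat 1)
  have h₁ := slope_tendsto _ (fun n => hx_pos (n + 1)) hlim
  have h₂ := slope_tendsto (fun n => 2 * x (n + 1))
    (fun n => mul_pos two_pos (hx_pos (n + 1))) (by simpa using hlim.const_mul 2)
  have hbound := (h₁.mul h₂).const_mul 2
  rw [mul_zero, mul_zero] at hbound
  have hratio : Tendsto (fun n => x n / x (n + 1) - 1) atTop (nhds 0) := by
    refine squeeze_zero (fun n => ?_) (fun n => ?_) hbound
    all_goals
      obtain ⟨s, hs, hn⟩ := hrec n
      have hy := hx_pos (n + 1)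
      have hfy := hfpos _ hy.ne'
      have hquot : x n / x (n + 1) - 1 = f (x (n + 1)) / x (n + 1) * s := by
        rw [hn]
        field_simp
        ring
      rw [hquot]
    · have hs₀ : 0 ≤ s := by
        have := hs 0
        rw [hf0] at this
        by_contra! hneg
        nlinarith
      positivity
    · have hs₂ : s ≤ 2 * (f (2 * x (n + 1)) / (2 * x (n + 1))) := by
        have := hs (2 * x (n + 1))
        have heq : 2 * (f (2 * x (n + 1)) / (2 * x (n + 1))) = f (2 * x (n + 1)) / x (n + 1) := by
          field_simp
        rw [heq, le_div_iff₀ hy]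
        linarith
      calc f (x (n + 1)) / x (n + 1) * s
          ≤ f (x (n + 1)) / x (n + 1) * (2 * (f (2 * x (n + 1)) / (2 * x (n + 1)))) := by gcongr
        _ = _ := by ring
  have hinv := (hratio.add_const 1).inv₀ (by norm_num)
  simpa using hinv
end

section
/- Let f : ℝ → ℝ be convex and even with f(0) = 0, f(x) > 0 for all x ≠ 0, and f'(0) = 0, and suppose f is differentiable on an interval (0, δ] for some δ > 0. Suppose there exist q ∈ ℝ and c > 0 such that f(x)·f'(x)/x^q → c as x ↓ 0. Let (x_n) be a strictly decreasing sequence of strictly positive real numbers with x_n → 0 satisfying x_n = x_{n+1} + f(x_{n+1})·f'(x_{n+1}) for every n (with x_{n+1} ∈ (0, δ]). Then (x_{n+1} − x_{n+2})/(x_n − x_{n+1}) → 1, i.e. the convergence of (x_n) to 0 is logarithmic. -/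
open Filter

theorem map_logarithmic (f : ℝ → ℝ)
    (hconv : ConvexOn ℝ Set.univ f)
    (heven : ∀ x : ℝ, f (-x) = f x)
    (hf0 : f 0 = 0)
    (hfpos : ∀ x : ℝ, x ≠ 0 → 0 < f x)
    (hderiv0 : HasDerivAt f 0 0)
    (δ : ℝ) (hδ : 0 < δ)
    (hdiff : ∀ t ∈ Set.Ioc (0 : ℝ) δ, DifferentiableAt ℝ f t)
    (q c : ℝ) (hc : 0 < c)
    (hlim : Tendsto (fun t => f t * deriv f t / t ^ q)
      (nhdsWithin 0 (Set.Ioi 0)) (nhds c))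
    (x : ℕ → ℝ)
    (hx_anti : StrictAnti x)
    (hx_pos : ∀ n, 0 < x n)
    (hx_lim : Tendsto x atTop (nhds 0))
    (hx_mem : ∀ n, x (n + 1) ∈ Set.Ioc (0 : ℝ) δ)
    (hrec : ∀ n, x n = x (n + 1) + f (x (n + 1)) * deriv f (x (n + 1))) :
    Tendsto (fun n => (x (n + 1) - x (n + 2)) / (x n - x (n + 1))) atTop (nhds 1) := by
  set g : ℝ → ℝ := fun t => f t * deriv f t with hg
  have hstep : ∀ n, x n - x (n + 1) = g (x (n + 1)) := fun n => by
    have := hrec n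
    simp only [hg]
    linarith
  have hgpos : ∀ n, 0 < g (x (n + 1)) := fun n => by
    rw [← hstep]
    exact sub_pos.2 (hx_anti n.lt_succ_self)
  have hx_within : Tendsto x atTop (nhdsWithin 0 (Set.Ioi 0)) :=
    tendsto_nhdsWithin_iff.2 ⟨hx_lim, Eventually.of_forall hx_pos⟩
  have hshift : ∀ k, Tendsto (fun n => x (n + k)) atTop (nhdsWithin 0 (Set.Ioi 0)) :=
    fun k => hx_within.comp (tendsto_add_atTop_nat k)
  have hderiv_le : ∀ n, deriv f (x (n + 1)) ≤ f (2 * δ) / δ := fun n => by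
    obtain ⟨h0, h1⟩ := hx_mem n
    calc deriv f (x (n + 1)) ≤ slope f (x (n + 1)) (2 * δ) :=
          hconv.deriv_le_slope (Set.mem_univ _) (Set.mem_univ _) (by linarith)
            (hdiff _ (hx_mem n))
      _ = (f (2 * δ) - f (x (n + 1))) / (2 * δ - x (n + 1)) := slope_def_field _ _ _
      _ ≤ f (2 * δ) / δ := by
          have := hfpos _ h0.ne'
          have := hfpos (2 * δ) (by positivity)
          gcongr <;> linarith
  have hf_div : Tendsto (fun n => f (x (n + 1)) / x (n + 1)) atTop (nhds 0) := by
    have h := (hasDerivAt_iff_tendsto_slope.1 hderiv0).comp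
      ((hshift 1).mono_right (nhdsWithin_mono 0 fun t (ht : 0 < t) => ht.ne'))
    refine h.congr fun n => ?_
    simp [slope_def_field, hf0]
  have hg_div : Tendsto (fun n => g (x (n + 1)) / x (n + 1)) atTop (nhds 0) := by
    refine squeeze_zero (g := fun n => f (x (n + 1)) / x (n + 1) * (f (2 * δ) / δ))
      (fun n => (div_pos (hgpos n) (hx_pos _)).le) (fun n => ?_) (by simpa using hf_div.mul_const _)
    have hfx := hfpos _ (hx_pos (n + 1)).ne'
    have hxn := hx_pos (n + 1)
    calc g (x (n + 1)) / x (n + 1) = f (x (n + 1)) / x (n + 1) * deriv f (x (n + 1)) := by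
          simp only [hg]; ring
      _ ≤ _ := mul_le_mul_of_nonneg_left (hderiv_le n) (by positivity)
  have hratio : Tendsto (fun n => x (n + 2) / x (n + 1)) atTop (nhds 1) := by
    have h : Tendsto (fun n => (1 + g (x (n + 2)) / x (n + 2))⁻¹) atTop (nhds 1) := by
      simpa using ((hg_div.comp (tendsto_add_atTop_nat 1)).const_add 1).inv₀ (by norm_num)
    refine h.congr fun n => ?_
    have hne := (hx_pos (n + 2)).ne'
    have hxs : x (n + 1) = x (n + 2) + g (x (n + 2)) := by linarith [hstep (n + 1)]
    rw [hxs, ← inv_div (_ + _), add_div, div_self hne]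
  have hpow : Tendsto (fun n => (x (n + 2) / x (n + 1)) ^ q) atTop (nhds 1) := by
    simpa using hratio.rpow_const (p := q) (Or.inl one_ne_zero)
  have hquot := ((hlim.comp (hshift 2)).div (hlim.comp (hshift 1)) hc.ne').mul hpow
  rw [div_self hc.ne', one_mul] at hquot
  refine hquot.congr fun n => ?_
  have h1 := Real.rpow_pos_of_pos (hx_pos (n + 1)) q
  have h2 := Real.rpow_pos_of_pos (hx_pos (n + 2)) q
  have h3 := (hgpos n).ne'
  rw [hstep n, hstep (n + 1)]
  simp only [Function.comp_apply, Pi.div_apply]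
  change g (x (n + 2)) / x (n + 2) ^ q / (g (x (n + 1)) / x (n + 1) ^ q) * _ =
    g (x (n + 2)) / g (x (n + 1))
  rw [Real.div_rpow (hx_pos _).le (hx_pos _).le]
  field_simp
end

section
/- Let R > 0 and 0 < x_0 ≤ R, and define the sequence (x_n) by x_{n+1} = R·x_n/√(x_n² + R²) for every n. Then for every n ∈ ℕ, x_n = R·x_0/√(n·x_0² + R²); consequently √n·x_n → R as n → ∞, and the convergence of (x_n) to 0 is logarithmic. -/
open Filter

theorem map_circle (R x0 : ℝ) (hR : 0 < R) (hx0 : 0 < x0) (hx0R : x0 ≤ R)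
    (x : ℕ → ℝ) (hinit : x 0 = x0)
    (hrec : ∀ n, x (n + 1) = R * x n / Real.sqrt (x n ^ 2 + R ^ 2)) :
    (∀ n : ℕ, x n = R * x0 / Real.sqrt (n * x0 ^ 2 + R ^ 2)) ∧
    Tendsto (fun n : ℕ => Real.sqrt n * x n) atTop (nhds R) ∧
    Tendsto x atTop (nhds 0) ∧
    Tendsto (fun n => x (n + 1) / x n) atTop (nhds 1) ∧
    Tendsto (fun n => (x (n + 1) - x (n + 2)) / (x n - x (n + 1))) atTop (nhds 1) := by
  have hclosed : ∀ n : ℕ, x n = R * x0 / Real.sqrt (n * x0 ^ 2 + R ^ 2) := by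
    intro n
    induction n with
    | zero => simp [hinit, Real.sqrt_sq hR.le, hR.ne']
    | succ k ih =>
      have hs : 0 < (k : ℝ) * x0 ^ 2 + R ^ 2 := by positivity
      have hs' : 0 < Real.sqrt (k * x0 ^ 2 + R ^ 2) := Real.sqrt_pos.2 hs
      have key : x k ^ 2 + R ^ 2
          = R ^ 2 * (((k + 1 : ℕ) : ℝ) * x0 ^ 2 + R ^ 2) / (k * x0 ^ 2 + R ^ 2) := by
        rw [ih, div_pow, Real.sq_sqrt hs.le]
        field_simp
        push_cast
        ring
      have ht : 0 < Real.sqrt (((k + 1 : ℕ) : ℝ) * x0 ^ 2 + R ^ 2) :=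
        Real.sqrt_pos.2 (by positivity)
      rw [hrec, key, Real.sqrt_div (by positivity), Real.sqrt_mul (by positivity),
        Real.sqrt_sq hR.le, ih]
      field_simp
  have hpos : ∀ n, 0 < x n := by
    intro n
    rw [hclosed]
    positivity
  have hzero : Tendsto x atTop (nhds 0) := by
    rw [funext hclosed]
    refine Tendsto.const_div_atTop (Real.tendsto_sqrt_atTop.comp ?_) _
    exact tendsto_atTop_add_const_right _ _
      (tendsto_natCast_atTop_atTop.atTop_mul_const (by positivity))
  have hsqrt : Tendsto (fun n : ℕ => Real.sqrt n * x n) atTop (nhds R) := by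
    have h := ((tendsto_natCast_div_add_atTop (𝕜 := ℝ) (R ^ 2 / x0 ^ 2)).sqrt).const_mul R
    rw [Real.sqrt_one, mul_one] at h
    refine h.congr fun n => ?_
    have hn : (n : ℝ) + R ^ 2 / x0 ^ 2 = (n * x0 ^ 2 + R ^ 2) / x0 ^ 2 := by field_simp
    rw [hclosed, Real.sqrt_div n.cast_nonneg, hn, Real.sqrt_div (by positivity),
      Real.sqrt_sq hx0.le]
    field_simp
  have hratio : Tendsto (fun n => x (n + 1) / x n) atTop (nhds 1) := by
    have h := (tendsto_const_nhds (x := R)).div ((hzero.pow 2).add_const (R ^ 2)).sqrt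
      (by simp [Real.sqrt_sq hR.le, hR.ne'])
    have h1 : R / Real.sqrt (0 ^ 2 + R ^ 2) = 1 := by simp [Real.sqrt_sq hR.le, hR.ne']
    rw [h1] at h
    refine h.congr fun n => ?_
    have := hpos n
    rw [hrec, Pi.div_apply]
    field_simp
  refine ⟨hclosed, hsqrt, hzero, hratio, ?_⟩
  have hdiff : ∀ n, x n - x (n + 1) = x n ^ 2 * x (n + 1) ^ 2 / (R ^ 2 * (x n + x (n + 1))) := by
    intro n
    have h0 := hpos n
    have h1 := hpos (n + 1)
    have hsq : x (n + 1) ^ 2 * (x n ^ 2 + R ^ 2) = R ^ 2 * x n ^ 2 := by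
      rw [hrec, div_pow, Real.sq_sqrt (by positivity)]
      field_simp
    rw [eq_div_iff (by positivity)]
    linarith
  have hratio' := hratio.comp (tendsto_add_atTop_nat 1)
  have h := ((hratio.mul (hratio'.pow 2)).mul (hratio.const_add 1)).div
    (hratio'.const_add 1) (by norm_num)
  have h1 : (1 : ℝ) * 1 ^ 2 * (1 + 1) / (1 + 1) = 1 := by norm_num
  rw [h1] at h
  refine h.congr fun n => ?_
  have h0 := hpos n
  have h1 := hpos (n + 1)
  have h2 := hpos (n + 2)
  rw [hdiff n, hdiff (n + 1)]
  simp only [Pi.div_apply, Function.comp_apply, add_assoc, Nat.reduceAdd]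
  field_simp
end

section
/- Let f : ℝ → ℝ be convex and even with f(0) = 0, f(x) > 0 for all x ≠ 0, and f'(0) = 0, and suppose f is differentiable on (0, δ) for some δ > 0 with f'(x)/x → L as x ↓ 0 for some real L ≥ 0. Let (x_n) be a strictly decreasing sequence of strictly positive real numbers with x_n → 0 and let (r_n) be a sequence of nonnegative real numbers with r_{n+1} = r_n + f(x_{n+1}) for every n and r_n → r_∞ for some r_∞ > 0, and suppose x_n = x_{n+1} + r_{n+1}·f'(x_{n+1}) for every n (with x_{n+1} ∈ (0, δ)). Then x_{n+1}/x_n → 1/(1 + r_∞·L). In particular, if L > 0 then (x_n) converges to 0 linearly with rate 1/(1 + r_∞·L), and if L = 0 then the convergence is sublinear. -/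
open Filter

theorem dra_rate (f : ℝ → ℝ)
    (hconv : ConvexOn ℝ Set.univ f)
    (heven : ∀ x : ℝ, f (-x) = f x)
    (hf0 : f 0 = 0)
    (hfpos : ∀ x : ℝ, x ≠ 0 → 0 < f x)
    (hderiv0 : HasDerivAt f 0 0)
    (δ : ℝ) (hδ : 0 < δ)
    (hdiff : ∀ t ∈ Set.Ioo (0 : ℝ) δ, DifferentiableAt ℝ f t)
    (L : ℝ) (hL : 0 ≤ L)
    (hlim : Tendsto (fun t => deriv f t / t) (nhdsWithin 0 (Set.Ioi 0)) (nhds L))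
    (x : ℕ → ℝ)
    (hx_anti : StrictAnti x)
    (hx_pos : ∀ n, 0 < x n)
    (hx_lim : Tendsto x atTop (nhds 0))
    (hx_mem : ∀ n, x (n + 1) ∈ Set.Ioo (0 : ℝ) δ)
    (r : ℕ → ℝ) (hr_nonneg : ∀ n, 0 ≤ r n)
    (hr_rec : ∀ n, r (n + 1) = r n + f (x (n + 1)))
    (r_inf : ℝ) (hr_inf : 0 < r_inf)
    (hr_lim : Tendsto r atTop (nhds r_inf))
    (hrec : ∀ n, x n = x (n + 1) + r (n + 1) * deriv f (x (n + 1))) :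
    Tendsto (fun n => x (n + 1) / x n) atTop (nhds (1 / (1 + r_inf * L))) := by
  have hx_within : Tendsto (fun n => x (n + 1)) atTop (nhdsWithin 0 (Set.Ioi 0)) :=
    tendsto_nhdsWithin_iff.2
      ⟨hx_lim.comp (tendsto_add_atTop_nat 1), Eventually.of_forall fun n => hx_pos (n + 1)⟩
  have hprod : Tendsto (fun n => 1 + r (n + 1) * (deriv f (x (n + 1)) / x (n + 1))) atTop
      (nhds (1 + r_inf * L)) :=
    ((hr_lim.comp (tendsto_add_atTop_nat 1)).mul (hlim.comp hx_within)).const_add 1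
  have hne : 1 + r_inf * L ≠ 0 := by positivity
  refine (tendsto_const_nhds.div hprod hne).congr fun n => ?_
  have hpos := hx_pos (n + 1)
  have hratio : 1 + r (n + 1) * (deriv f (x (n + 1)) / x (n + 1)) = x n / x (n + 1) := by
    rw [hrec n]
    field_simp
  simp only [Pi.div_apply, hratio, one_div_div]
end

section
/- Let f : ℝ → ℝ be convex and even with f(0) = 0, f(x) > 0 for all x ≠ 0, and f'(0) = 0, and suppose f is differentiable on (0, δ) for some δ > 0 and there exist q > 1 and c > 0 such that f'(x)/x^q → c as x ↓ 0. Let (x_n) be a strictly decreasing sequence of strictly positive real numbers with x_n → 0 and let (r_n) be a sequence of nonnegative real numbers with r_{n+1} = r_n + f(x_{n+1}) for every n and r_n → r_∞ for some r_∞ > 0, and suppose x_n = x_{n+1} + r_{n+1}·f'(x_{n+1}) for every n (with x_{n+1} ∈ (0, δ)). Then the convergence of (x_n) to 0 is logarithmic, i.e. x_{n+1}/x_n → 1 and (x_{n+1} − x_{n+2})/(x_n − x_{n+1}) → 1, and moreover n^{1/(q−1)}·x_n → ((q−1)·r_∞·c)^{−1/(q−1)}. -/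
open Filter

/-- If `x n - x (n + 1) = a n * x (n + 1) ^ q` with `a` convergent and `x → 0`, then
`x n / x (n + 1) = 1 + a n * x (n + 1) ^ (q - 1)` and this tends to `1`. -/
theorem tendsto_div_succ_of_sub_eq_mul_rpow {x a : ℕ → ℝ} {q K : ℝ} (hq : 1 < q)
    (hpos : ∀ n, 0 < x n) (hlim : Tendsto x atTop (nhds 0)) (ha : Tendsto a atTop (nhds K))
    (hrec : ∀ n, x n - x (n + 1) = a n * x (n + 1) ^ q) :
    Tendsto (fun n => a n * x (n + 1) ^ (q - 1)) atTop (nhds 0) ∧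
    (∀ n, x n / x (n + 1) = 1 + a n * x (n + 1) ^ (q - 1)) ∧
    Tendsto (fun n => x n / x (n + 1)) atTop (nhds 1) := by
  have hp : 0 < q - 1 := sub_pos.2 hq
  have hh : Tendsto (fun n => a n * x (n + 1) ^ (q - 1)) atTop (nhds 0) := by
    have := ha.mul (((tendsto_add_atTop_iff_nat 1).2 hlim).rpow_const (p := q - 1) (Or.inr hp.le))
    simpa [Real.zero_rpow hp.ne'] using this
  have heq : ∀ n, x n / x (n + 1) = 1 + a n * x (n + 1) ^ (q - 1) := by
    intro n
    have hy := hpos (n + 1)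
    rw [Real.rpow_sub_one hy.ne']
    have := hrec n
    field_simp
    linarith
  refine ⟨hh, heq, ?_⟩
  simp_rw [heq]
  simpa using hh.const_add 1

/-- The successive differences of `u n = x n ^ (-(q - 1))` converge to `(q - 1) * K`. -/
theorem tendsto_rpow_sub_of_sub_eq_mul_rpow {x a : ℕ → ℝ} {q K : ℝ} (hq : 1 < q) (hK : 0 < K)
    (hpos : ∀ n, 0 < x n) (hlim : Tendsto x atTop (nhds 0)) (ha : Tendsto a atTop (nhds K))
    (hrec : ∀ n, x n - x (n + 1) = a n * x (n + 1) ^ q) :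
    Tendsto (fun n => x (n + 1) ^ (-(q - 1)) - x n ^ (-(q - 1))) atTop
      (nhds ((q - 1) * K)) := by
  obtain ⟨hh, heq, -⟩ := tendsto_div_succ_of_sub_eq_mul_rpow hq hpos hlim ha hrec
  have ha_pos : ∀ᶠ n in atTop, 0 < a n := ha.eventually_const_lt hK
  have hder : HasDerivAt (fun t : ℝ => t ^ (-(q - 1))) (-(q - 1)) 1 := by
    simpa using Real.hasDerivAt_rpow_const (x := 1) (p := -(q - 1)) (Or.inl one_ne_zero)
  have hne : ∀ᶠ n in atTop, a n * x (n + 1) ^ (q - 1) ∈ ({0}ᶜ : Set ℝ) := by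
    filter_upwards [ha_pos] with n hn
    exact (mul_pos hn (Real.rpow_pos_of_pos (hpos _) _)).ne'
  have hslope := (hasDerivAt_iff_tendsto_slope_zero.1 hder).comp
    (tendsto_nhdsWithin_iff.2 ⟨hh, hne⟩)
  have hmul := (ha.mul hslope).neg
  rw [show -(K * -(q - 1)) = (q - 1) * K by ring] at hmul
  refine hmul.congr' ?_
  filter_upwards [ha_pos] with n hn
  have hy := hpos (n + 1)
  have hyp := Real.rpow_pos_of_pos hy (q - 1)
  simp only [Function.comp_apply, smul_eq_mul, Real.one_rpow]
  rw [← heq n, Real.div_rpow (hpos n).le hy.le, Real.rpow_neg hy.le]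
  field_simp
  ring

/-- A positive null sequence with `x n - x (n + 1) ~ K * x (n + 1) ^ q` decays like
`((q - 1) * K * n) ^ (-(1 / (q - 1)))`. -/
theorem tendsto_rpow_mul_of_sub_eq_mul_rpow {x a : ℕ → ℝ} {q K : ℝ} (hq : 1 < q) (hK : 0 < K)
    (hpos : ∀ n, 0 < x n) (hlim : Tendsto x atTop (nhds 0)) (ha : Tendsto a atTop (nhds K))
    (hrec : ∀ n, x n - x (n + 1) = a n * x (n + 1) ^ q) :
    Tendsto (fun n : ℕ => (n : ℝ) ^ (1 / (q - 1)) * x n) atTop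
      (nhds (((q - 1) * K) ^ (-(1 / (q - 1))))) := by
  have hp : 0 < q - 1 := sub_pos.2 hq
  have hces := (tendsto_rpow_sub_of_sub_eq_mul_rpow hq hK hpos hlim ha hrec).cesaro
  simp_rw [Finset.sum_range_sub (fun n => x n ^ (-(q - 1)))] at hces
  have hu : Tendsto (fun n : ℕ => (n : ℝ)⁻¹ * x n ^ (-(q - 1))) atTop (nhds ((q - 1) * K)) := by
    have := hces.add
      ((tendsto_inv_atTop_nhds_zero_nat (𝕜 := ℝ)).mul_const (x 0 ^ (-(q - 1))))
    simpa only [← mul_add, sub_add_cancel, zero_mul, add_zero] using this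
  have hpow := hu.rpow_const (p := -(1 / (q - 1))) (Or.inl (by positivity))
  refine hpow.congr fun n => ?_
  rw [Real.mul_rpow (by positivity) (Real.rpow_nonneg (hpos n).le _),
    ← Real.rpow_mul (hpos n).le, Real.inv_rpow n.cast_nonneg, Real.rpow_neg n.cast_nonneg, inv_inv,
    neg_mul_neg, mul_one_div_cancel hp.ne', Real.rpow_one]

theorem dra_logarithmic (f : ℝ → ℝ)
    (hconv : ConvexOn ℝ Set.univ f)
    (heven : ∀ x : ℝ, f (-x) = f x)
    (hf0 : f 0 = 0)
    (hfpos : ∀ x : ℝ, x ≠ 0 → 0 < f x)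
    (hderiv0 : HasDerivAt f 0 0)
    (δ : ℝ) (hδ : 0 < δ)
    (hdiff : ∀ t ∈ Set.Ioo (0 : ℝ) δ, DifferentiableAt ℝ f t)
    (q c : ℝ) (hq : 1 < q) (hc : 0 < c)
    (hlim : Tendsto (fun t => deriv f t / t ^ q) (nhdsWithin 0 (Set.Ioi 0)) (nhds c))
    (x : ℕ → ℝ)
    (hx_anti : StrictAnti x)
    (hx_pos : ∀ n, 0 < x n)
    (hx_lim : Tendsto x atTop (nhds 0))
    (hx_mem : ∀ n, x (n + 1) ∈ Set.Ioo (0 : ℝ) δ)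
    (r : ℕ → ℝ) (hr_nonneg : ∀ n, 0 ≤ r n)
    (hr_rec : ∀ n, r (n + 1) = r n + f (x (n + 1)))
    (r_inf : ℝ) (hr_inf : 0 < r_inf)
    (hr_lim : Tendsto r atTop (nhds r_inf))
    (hrec : ∀ n, x n = x (n + 1) + r (n + 1) * deriv f (x (n + 1))) :
    Tendsto (fun n => x (n + 1) / x n) atTop (nhds 1) ∧
    Tendsto (fun n => (x (n + 1) - x (n + 2)) / (x n - x (n + 1))) atTop (nhds 1) ∧
    Tendsto (fun n : ℕ => (n : ℝ) ^ (1 / (q - 1)) * x n) atTop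
      (nhds (((q - 1) * r_inf * c) ^ (-(1 / (q - 1))))) := by
  set a : ℕ → ℝ := fun n => r (n + 1) * (deriv f (x (n + 1)) / x (n + 1) ^ q) with ha_def
  have hsub : ∀ n, x n - x (n + 1) = a n * x (n + 1) ^ q := by
    intro n
    have hy := Real.rpow_pos_of_pos (hx_pos (n + 1)) q
    rw [ha_def, mul_assoc, div_mul_cancel₀ _ hy.ne']
    linarith [hrec n]
  have hK : 0 < r_inf * c := mul_pos hr_inf hc
  have ha : Tendsto a atTop (nhds (r_inf * c)) :=
    ((tendsto_add_atTop_iff_nat 1).2 hr_lim).mul <| hlim.comp <| tendsto_nhdsWithin_iff.2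
      ⟨(tendsto_add_atTop_iff_nat 1).2 hx_lim, Eventually.of_forall fun n => hx_pos (n + 1)⟩
  have hratio : Tendsto (fun n => x (n + 1) / x n) atTop (nhds 1) := by
    simpa using (tendsto_div_succ_of_sub_eq_mul_rpow hq hx_pos hx_lim ha hsub).2.2.inv₀ one_ne_zero
  refine ⟨hratio, ?_, ?_⟩
  · have h := (((tendsto_add_atTop_iff_nat 1).2 ha).div ha hK.ne').mul
      (((tendsto_add_atTop_iff_nat 1).2 hratio).rpow_const (p := q) (Or.inl one_ne_zero))
    rw [div_self hK.ne', Real.one_rpow, one_mul] at h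
    refine h.congr fun n => ?_
    rw [Real.div_rpow (hx_pos _).le (hx_pos _).le, hsub n, hsub (n + 1)]
    exact div_mul_div_comm _ _ _ _
  · simpa only [mul_assoc] using
      tendsto_rpow_mul_of_sub_eq_mul_rpow hq hK hx_pos hx_lim ha hsub
end

section
/- Let X be a real Hilbert space, let f : X → ℝ be convex and lower semicontinuous, and let z ∈ X be a minimizer of f. Let (x_n) be a sequence in X such that for every n, x_{n+1} is a minimizer of y ↦ f(y) + ½‖x_n − y‖², and suppose x_n → z (in norm). Then f(x_n) − f(z) = o(1/n), i.e. n·(f(x_n) − f(z)) → 0 as n → ∞. -/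
open Filter

/-- If `p` minimizes `y ↦ f y + ‖w - y‖ ^ 2 / 2` for a convex `f`, then
`w - p` is a subgradient of `f` at `p`. -/
lemma ConvexOn.sub_le_inner_of_prox
    {X : Type*} [NormedAddCommGroup X] [InnerProductSpace ℝ X] {f : X → ℝ}
    (hconv : ConvexOn ℝ Set.univ f) {w p : X}
    (hp : ∀ y : X, f p + ‖w - p‖ ^ 2 / 2 ≤ f y + ‖w - y‖ ^ 2 / 2) (y : X) :
    f p - f y ≤ inner ℝ (w - p) (p - y) := by
  have key : ∀ t ∈ Set.Ioo (0 : ℝ) 1,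
      f p - f y ≤ inner ℝ (w - p) (p - y) + t * (‖p - y‖ ^ 2 / 2) := by
    rintro t ⟨ht0, ht1⟩
    have hc := hconv.2 (Set.mem_univ p) (Set.mem_univ y) (sub_nonneg.2 ht1.le) ht0.le
      (sub_add_cancel 1 t)
    have hm := hp ((1 - t) • p + t • y)
    have hw : w - ((1 - t) • p + t • y) = (w - p) + t • (p - y) := by module
    rw [hw, norm_add_sq_real, real_inner_smul_right, norm_smul, mul_pow, Real.norm_eq_abs,
      sq_abs] at hm
    simp only [smul_eq_mul] at hc
    refine le_of_mul_le_mul_left ?_ ht0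
    linarith
  have hlim : Tendsto (fun t : ℝ => inner ℝ (w - p) (p - y) + t * (‖p - y‖ ^ 2 / 2))
      (nhdsWithin 0 (Set.Ioi 0)) (nhds (inner ℝ (w - p) (p - y))) := by
    have h : Continuous fun t : ℝ => inner ℝ (w - p) (p - y) + t * (‖p - y‖ ^ 2 / 2) := by
      fun_prop
    simpa using (h.tendsto 0).mono_left nhdsWithin_le_nhds
  exact ge_of_tendsto hlim (eventually_of_mem (Ioo_mem_nhdsGT one_pos) key)

/-- The three-point inequality for a proximal step of a convex function. -/
lemma ConvexOn.two_mul_sub_le_of_prox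
    {X : Type*} [NormedAddCommGroup X] [InnerProductSpace ℝ X] {f : X → ℝ}
    (hconv : ConvexOn ℝ Set.univ f) {w p : X}
    (hp : ∀ y : X, f p + ‖w - p‖ ^ 2 / 2 ≤ f y + ‖w - y‖ ^ 2 / 2) (y : X) :
    2 * (f p - f y) ≤ ‖w - y‖ ^ 2 - ‖p - y‖ ^ 2 := by
  have h := norm_add_sq_real (w - p) (p - y)
  rw [sub_add_sub_cancel] at h
  linarith [hconv.sub_le_inner_of_prox hp y, sq_nonneg ‖w - p‖]

/-- An antitone nonnegative sequence dominated by the decrements of a nonnegative null sequence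
is `o(1 / n)`. -/
lemma Antitone.tendsto_natCast_mul_of_le_sub {d a : ℕ → ℝ} (hd : Antitone d)
    (hd0 : ∀ n, 0 ≤ d n) (ha0 : ∀ n, 0 ≤ a n) (hda : ∀ n, 2 * d (n + 1) ≤ a n - a (n + 1))
    (ha : Tendsto a atTop (nhds 0)) :
    Tendsto (fun n : ℕ => (n : ℝ) * d n) atTop (nhds 0) := by
  have hsum : ∀ m k : ℕ, 2 * k * d (m + k) ≤ a m - a (m + k) := by
    intro m k
    induction k with
    | zero => simp
    | succ k ih =>
      have h := mul_le_mul_of_nonneg_left (hd (Nat.le_succ (m + k)))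
        (by positivity : (0 : ℝ) ≤ 2 * k)
      have := hda (m + k)
      rw [← add_assoc]
      push_cast
      linarith
  refine squeeze_zero (fun n => mul_nonneg n.cast_nonneg (hd0 n)) (fun n => ?_)
    (ha.comp (Nat.tendsto_div_const_atTop two_ne_zero))
  have h := hsum (n / 2) (n - n / 2)
  rw [Nat.add_sub_cancel' (Nat.div_le_self n 2)] at h
  have hn : (n : ℝ) ≤ 2 * (n - n / 2 : ℕ) := by
    exact_mod_cast (by omega : n ≤ 2 * (n - n / 2))
  have := mul_le_mul_of_nonneg_right hn (hd0 n)
  simp only [Function.comp_apply]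
  linarith [ha0 n]

theorem guler_little_o
    {X : Type*} [NormedAddCommGroup X] [InnerProductSpace ℝ X] [CompleteSpace X]
    (f : X → ℝ)
    (hconv : ConvexOn ℝ Set.univ f)
    (hlsc : LowerSemicontinuous f)
    (z : X) (hz : ∀ y : X, f z ≤ f y)
    (x : ℕ → X)
    (hprox : ∀ n : ℕ, ∀ y : X,
      f (x (n + 1)) + ‖x n - x (n + 1)‖ ^ 2 / 2 ≤ f y + ‖x n - y‖ ^ 2 / 2)
    (hx_lim : Tendsto x atTop (nhds z)) :
    Tendsto (fun n : ℕ => (n : ℝ) * (f (x n) - f z)) atTop (nhds 0) := by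
  refine Antitone.tendsto_natCast_mul_of_le_sub (a := fun n => ‖x n - z‖ ^ 2)
    (antitone_nat_of_succ_le fun n => ?_) (fun n => sub_nonneg.2 (hz _))
    (fun n => sq_nonneg _) (fun n => hconv.two_mul_sub_le_of_prox (hprox n) z) ?_
  · have h := hprox n (x n)
    rw [sub_self, norm_zero] at h
    linarith [sq_nonneg ‖x n - x (n + 1)‖]
  · simpa using (tendsto_iff_norm_sub_tendsto_zero.1 hx_lim).pow 2
end
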